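/- Let F be a finite field of characteristic 2 and order q. Then the Weil spectrum {W_{F,q−2}(a) : a ∈ F, a ≠ 0} is exactly the set of integers t that are divisible by 4 and satisfy 1 − 2√q ≤ t ≤ 1 + 2√q. -/

import Mathlib

open scoped BigOperators

/-- The canonical additive character of a finite field `F` of characteristic `p`:
`ψ(x) = exp(2πi·Tr(x)/p)`, where `Tr` is the absolute trace from `F` to `𝔽_p = ZMod p`. -/
noncomputable def canonicalPsi (F : Type*) [Field F] [Fintype F] (p : ℕ) [CharP F p]
    (x : F) : ℂ :=
  letI : Algebra (ZMod p) F := ZMod.algebra F p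
  Complex.exp (2 * Real.pi * Complex.I * ((Algebra.trace (ZMod p) F x).val : ℂ) / (p : ℂ))

/-- The Weil sum `W_{F,d}(a) = ∑_{x ∈ F} ψ(x^d − a·x)`. -/
noncomputable def weilSum (F : Type*) [Field F] [Fintype F] (p : ℕ) [CharP F p]
    (d : ℕ) (a : F) : ℂ :=
  ∑ x : F, canonicalPsi F p (x ^ d - a * x)

namespace Kloosterman

open Finset

section Character

variable (F : Type*) [Field F] [Algebra (ZMod 2) F]

/-- The canonical additive character of a field of characteristic `2`, with integer values. -/
noncomputable def signChar : AddChar F ℤ where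
  toFun x := if Algebra.trace (ZMod 2) F x = 0 then 1 else -1
  map_zero_eq_one' := by simp
  map_add_eq_mul' x y := by
    rw [map_add]
    generalize Algebra.trace (ZMod 2) F x = u
    generalize Algebra.trace (ZMod 2) F y = v
    revert u v
    decide

variable {F}

theorem signChar_apply (x : F) :
    signChar F x = if Algebra.trace (ZMod 2) F x = 0 then 1 else -1 := rfl

theorem signChar_eq_one_iff {x : F} : signChar F x = 1 ↔ Algebra.trace (ZMod 2) F x = 0 := by
  rw [signChar_apply]; split_ifs with h <;> simp [h]

theorem signChar_eq_one_or (x : F) : signChar F x = 1 ∨ signChar F x = -1 := by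
  rw [signChar_apply]; split_ifs <;> simp

theorem signChar_ne_one [Finite F] : signChar F ≠ 1 := by
  intro h
  obtain ⟨x, hx⟩ := Algebra.trace_surjective (ZMod 2) F 1
  have := signChar_eq_one_iff.1 (show signChar F x = 1 by rw [h]; rfl)
  rw [hx] at this
  exact one_ne_zero this

theorem signChar_algebraTrace {E : Type*} [Field E] [Algebra (ZMod 2) E] [Algebra F E]
    [Finite F] [Finite E] (x : E) : signChar F (Algebra.trace F E x) = signChar E x := by
  have : IsScalarTower (ZMod 2) F E := .of_algebraMap_eq' (Subsingleton.elim _ _)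
  rw [signChar_apply, signChar_apply, Algebra.trace_trace]

variable [Fintype F]

theorem sum_signChar_mul [DecidableEq F] (b : F) :
    ∑ x, signChar F (x * b) = if b = 0 then (Fintype.card F : ℤ) else 0 := by
  rw [AddChar.sum_mulShift b (AddChar.IsPrimitive.of_ne_one signChar_ne_one)]
  split_ifs <;> rfl

/-- The Kloosterman sum over a field of characteristic `2`; because `0⁻¹ = 0`, it includes
the term `1` for `x = 0`. -/
noncomputable def klSum (a : F) : ℤ := ∑ x, signChar F (x + a * x⁻¹)

theorem klSum_eq_card_sub (a : F) :
    klSum a = Fintype.card F - 2 * #{x : F | signChar F (x + a * x⁻¹) = -1} := by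
  classical
  have h (x : F) : signChar F (x + a * x⁻¹) =
      1 - 2 * (if signChar F (x + a * x⁻¹) = -1 then 1 else 0) := by
    rcases signChar_eq_one_or (x + a * x⁻¹) with h | h <;> simp [h]
  rw [klSum, sum_congr rfl fun x _ ↦ h x, sum_sub_distrib, ← mul_sum, sum_boole]
  simp

theorem four_dvd_klSum (hq : 4 ∣ Fintype.card F) {a : F} (ha : a ≠ 0) : 4 ∣ klSum a := by
  classical
  have : CharP F 2 := charP_of_injective_algebraMap (algebraMap (ZMod 2) F).injective 2
  have key : ((#{x : F | signChar F (x + a * x⁻¹) = -1} : ℕ) : ZMod 2) = 0 := by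
    rw [card_eq_sum_ones, Nat.cast_sum]
    refine sum_involution (fun x _ ↦ a * x⁻¹) (fun _ _ ↦ by decide) ?_ ?_ ?_
    · intro x hx _ h
      simp only [mem_filter, mem_univ, true_and] at hx
      rw [h, CharTwo.add_self_eq_zero, AddChar.map_zero_eq_one] at hx
      norm_num at hx
    · intro x hx
      simp only [mem_filter, mem_univ, true_and, mul_inv, inv_inv] at hx ⊢
      rw [← mul_assoc, mul_inv_cancel₀ ha, one_mul, add_comm, hx]
    · intro x hx
      rw [mul_inv, inv_inv, ← mul_assoc, mul_inv_cancel₀ ha, one_mul]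
  obtain ⟨m, hm⟩ := (ZMod.natCast_eq_zero_iff _ 2).1 key
  rw [klSum_eq_card_sub, hm]
  obtain ⟨r, hr⟩ := hq
  rw [hr]
  exact ⟨r - m, by push_cast; ring⟩

end Character

section Doubling

variable {F : Type*} [Field F] [Fintype F]

theorem card_trace_norm_fibre_le {E : Type*} [Field E] [Fintype E] [Algebra F E] [CharP F 2]
    [DecidableEq F] (hE : Module.finrank F E = 2) (s n : F) :
    #{x : E | (Algebra.trace F E x, Algebra.norm F x) = (s, n)} +
      #{p : F × F | (p.1 + p.2, p.1 * p.2) = (s, n)} ≤ 2 := by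
  classical
  have : CharP E 2 := charP_of_injective_algebraMap (algebraMap F E).injective 2
  have htr (x : E) : algebraMap F E (Algebra.trace F E x) = x + x ^ Nat.card F := by
    rw [FiniteField.algebraMap_trace_eq_sum_pow, hE]; simp [sum_range_succ]
  have hno (x : E) : algebraMap F E (Algebra.norm F x) = x * x ^ Nat.card F := by
    rw [FiniteField.algebraMap_norm_eq_prod_pow, hE]; simp [prod_range_succ]
  have hroot (x y : E) (hy : Algebra.trace F E y = Algebra.trace F E x)
      (hy' : Algebra.norm F y = Algebra.norm F x) : y = x ∨ y = x ^ Nat.card F := by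
    have h1 : (y - x) * (y - x ^ Nat.card F) = 0 := by
      linear_combination y * htr x - hno x - y * htr y + hno y + y * congrArg (algebraMap F E) hy
        - congrArg (algebraMap F E) hy'
    rcases mul_eq_zero.1 h1 with h | h
    · exact .inl (sub_eq_zero.1 h)
    · exact .inr (sub_eq_zero.1 h)
  rcases (univ.filter fun p : F × F ↦ (p.1 + p.2, p.1 * p.2) = (s, n)).eq_empty_or_nonempty with
    h0 | ⟨⟨u, v⟩, huv⟩
  · rw [h0, card_empty, add_zero]
    rcases (univ.filter fun x : E ↦
      (Algebra.trace F E x, Algebra.norm F x) = (s, n)).eq_empty_or_nonempty with h1 | ⟨x, hx⟩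
    · rw [h1, card_empty]; exact Nat.zero_le _
    · refine (card_le_card (t := {x, x ^ Nat.card F}) fun y hy ↦ ?_).trans card_le_two
      simp only [mem_filter, mem_univ, true_and, Prod.mk.injEq] at hx hy
      simpa using hroot x y (hy.1.trans hx.1.symm) (hy.2.trans hx.2.symm)
  · simp only [mem_filter, mem_univ, true_and, Prod.mk.injEq] at huv
    obtain ⟨rfl, rfl⟩ := huv
    have hB : (univ.filter fun p : F × F ↦ (p.1 + p.2, p.1 * p.2) = (u + v, u * v)) ⊆
        {(u, v), (v, u)} := by
      rintro ⟨x, y⟩ h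
      simp only [mem_filter, mem_univ, true_and, Prod.mk.injEq] at h
      simp only [mem_insert, mem_singleton, Prod.mk.injEq]
      have : (x - u) * (x - v) = 0 := by linear_combination x * h.1 - h.2
      rcases mul_eq_zero.1 this with h' | h'
      · rw [sub_eq_zero] at h'
        subst h'
        exact .inl ⟨rfl, by linear_combination h.1⟩
      · rw [sub_eq_zero] at h'
        subst h'
        exact .inr ⟨rfl, by linear_combination h.1⟩
    have hA (x : E) (hx : Algebra.trace F E x = u + v) (hx' : Algebra.norm F x = u * v) :
        u = v ∧ x = algebraMap F E u := by
      have h1 : (x - algebraMap F E u) * (x - algebraMap F E v) = 0 := by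
        have e1 := congrArg (algebraMap F E) hx
        have e2 := congrArg (algebraMap F E) hx'
        rw [htr, map_add] at e1
        rw [hno, map_mul] at e2
        linear_combination x * e1 - e2
      have h2 : ∃ w : F, (w = u ∨ w = v) ∧ x = algebraMap F E w := by
        rcases mul_eq_zero.1 h1 with h | h
        · exact ⟨u, .inl rfl, sub_eq_zero.1 h⟩
        · exact ⟨v, .inr rfl, sub_eq_zero.1 h⟩
      obtain ⟨w, hw, rfl⟩ := h2
      have h3 : u + v = 0 := by
        rw [← hx, Algebra.trace_algebraMap, hE, two_nsmul, CharTwo.add_self_eq_zero]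
      have h4 : u = v := CharTwo.add_eq_zero.1 h3
      subst h4
      exact ⟨rfl, by simpa using hw⟩
    by_cases h : u = v
    · subst h
      have hA' : (univ.filter fun x : E ↦
          (Algebra.trace F E x, Algebra.norm F x) = (u + u, u * u)) ⊆ {algebraMap F E u} := by
        intro x hx
        simp only [mem_filter, mem_univ, true_and, Prod.mk.injEq] at hx
        simpa using (hA x hx.1 hx.2).2
      have h1 := card_le_card hA'
      have h2 := card_le_card hB
      simp only [card_singleton, pair_eq_singleton] at h1 h2
      omega
    · have hA' : (univ.filter fun x : E ↦
          (Algebra.trace F E x, Algebra.norm F x) = (u + v, u * v)) = ∅ := by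
        refine filter_eq_empty_iff.2 fun x _ hx ↦ ?_
        simp only [Prod.mk.injEq] at hx
        exact h (hA x hx.1 hx.2).1
      rw [hA', card_empty, zero_add]
      exact (card_le_card hB).trans card_le_two

theorem card_trace_norm_fibre {E : Type*} [Field E] [Fintype E] [Algebra F E] [CharP F 2]
    [DecidableEq F] (hE : Module.finrank F E = 2) (p : F × F) :
    #{x : E | (Algebra.trace F E x, Algebra.norm F x) = p} +
      #{r : F × F | (r.1 + r.2, r.1 * r.2) = p} = 2 := by
  have h := (sum_eq_sum_iff_of_le (s := (univ : Finset (F × F)))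
    fun p _ ↦ card_trace_norm_fibre_le (E := E) hE p.1 p.2).1 ?_
  · exact h p (mem_univ _)
  · have h1 := card_eq_sum_card_fiberwise (s := (univ : Finset E)) (t := (univ : Finset (F × F)))
      (f := fun x ↦ (Algebra.trace F E x, Algebra.norm F x)) fun _ _ ↦ mem_coe.2 (mem_univ _)
    have h2 := card_eq_sum_card_fiberwise (s := (univ : Finset (F × F)))
      (t := (univ : Finset (F × F))) (f := fun r ↦ (r.1 + r.2, r.1 * r.2))
      fun _ _ ↦ mem_coe.2 (mem_univ _)
    have h3 : Fintype.card E = Fintype.card F ^ 2 := by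
      rw [← hE]; exact Module.card_eq_pow_finrank
    simp only [card_univ, Fintype.card_prod] at h1 h2
    rw [sum_add_distrib, ← h1, ← h2, sum_const, card_univ, Fintype.card_prod, h3]
    simp only [smul_eq_mul]
    ring

/-- The Kloosterman sum (without the term for `x = 0`) over a quadratic extension. -/
theorem klSum_quadratic_extension [Algebra (ZMod 2) F] {E : Type*} [Field E] [Fintype E] [Algebra (ZMod 2) E]
    [Algebra F E] (hE : Module.finrank F E = 2) {a : F} (ha : a ≠ 0) :
    klSum (algebraMap F E a) - 1 = 2 * Fintype.card F - (klSum a - 1) ^ 2 := by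
  classical
  have : CharP F 2 := charP_of_injective_algebraMap (algebraMap (ZMod 2) F).injective 2
  let f : F × F → ℤ := fun p ↦ if p.2 = 0 then 0 else signChar F (p.1 + a * p.1 * p.2⁻¹)
  have hsub : klSum a - 1 = ∑ x : F, if x = 0 then 0 else signChar F (x + a * x⁻¹) := by
    rw [klSum, ← add_sum_erase _ _ (mem_univ (0 : F))]
    conv_rhs => rw [← add_sum_erase _ _ (mem_univ (0 : F))]
    simp only [inv_zero, mul_zero, add_zero, AddChar.map_zero_eq_one, if_true, zero_add,
      add_sub_cancel_left]
    exact sum_congr rfl fun x hx ↦ by rw [if_neg (ne_of_mem_erase hx)]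
  have h1 : klSum (algebraMap F E a) - 1 =
      ∑ x : E, f (Algebra.trace F E x, Algebra.norm F x) := by
    rw [klSum, ← add_sum_erase _ _ (mem_univ (0 : E))]
    conv_rhs => rw [← add_sum_erase _ _ (mem_univ (0 : E))]
    simp only [inv_zero, mul_zero, add_zero, AddChar.map_zero_eq_one, add_sub_cancel_left, f,
      Algebra.norm_eq_zero_iff, if_true, zero_add]
    refine sum_congr rfl fun x hx ↦ ?_
    have hx0 := ne_of_mem_erase hx
    rw [if_neg hx0, ← signChar_algebraTrace (F := F)]
    congr 1
    have htr (x : E) : algebraMap F E (Algebra.trace F E x) = x + x ^ Nat.card F := by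
      rw [FiniteField.algebraMap_trace_eq_sum_pow, hE]; simp [sum_range_succ]
    have hno (x : E) : algebraMap F E (Algebra.norm F x) = x * x ^ Nat.card F := by
      rw [FiniteField.algebraMap_norm_eq_prod_pow, hE]; simp [prod_range_succ]
    rw [map_add, ← Algebra.smul_def, map_smul, smul_eq_mul]
    congr 1
    rw [mul_assoc]
    congr 1
    apply (algebraMap F E).injective
    rw [map_mul, map_inv₀ (algebraMap F E), htr, htr, hno, inv_pow]
    field_simp
    ring
  have h2 : (klSum a - 1) ^ 2 = ∑ r : F × F, f (r.1 + r.2, r.1 * r.2) := by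
    rw [sq, hsub, Fintype.sum_mul_sum, Fintype.sum_prod_type]
    refine sum_congr rfl fun x _ ↦ sum_congr rfl fun y _ ↦ ?_
    by_cases hx : x = 0
    · simp [hx, f]
    by_cases hy : y = 0
    · simp [hy, f]
    simp only [f, hx, hy, if_false, mul_eq_zero, or_self]
    rw [← AddChar.map_add_eq_mul]
    congr 1
    field_simp
    ring
  have h3 : ∑ p : F × F, f p = Fintype.card F := by
    rw [Fintype.sum_prod_type_right, ← add_sum_erase _ _ (mem_univ a), sum_eq_zero (s := univ.erase a),
      add_zero]
    · simp only [f, ha, if_false]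
      refine (sum_congr rfl fun x _ ↦ ?_).trans ((sum_const (1 : ℤ)).trans (by simp))
      rw [mul_comm a x, mul_assoc, mul_inv_cancel₀ ha, mul_one, CharTwo.add_self_eq_zero,
        AddChar.map_zero_eq_one]
    · intro n hn
      have hn := ne_of_mem_erase hn
      by_cases h0 : n = 0
      · simp [f, h0]
      simp only [f, h0, if_false]
      have hne : 1 + a * n⁻¹ ≠ 0 := fun h ↦ hn (by
        have h' := CharTwo.add_eq_zero.1 h
        field_simp at h'
        exact h')
      have := sum_signChar_mul (1 + a * n⁻¹)
      rw [if_neg hne] at this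
      rw [← this]
      refine sum_congr rfl fun x _ ↦ ?_
      congr 1
      ring
  have h4 : ∑ x : E, f (Algebra.trace F E x, Algebra.norm F x) +
      ∑ r : F × F, f (r.1 + r.2, r.1 * r.2) = 2 * ∑ p : F × F, f p := by
    rw [← sum_fiberwise_of_maps_to' (s := (univ : Finset E)) (t := (univ : Finset (F × F)))
      (g := fun x ↦ (Algebra.trace F E x, Algebra.norm F x)) (fun _ _ ↦ mem_univ _) f,
      ← sum_fiberwise_of_maps_to' (s := (univ : Finset (F × F))) (t := (univ : Finset (F × F)))
      (g := fun r ↦ (r.1 + r.2, r.1 * r.2)) (fun _ _ ↦ mem_univ _) f, ← sum_add_distrib, mul_sum]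
    refine sum_congr rfl fun p _ ↦ ?_
    rw [sum_const, sum_const, ← add_smul, card_trace_norm_fibre hE, two_nsmul, two_mul]
  linear_combination h1 + h4 + 2 * h3 + h2

end Doubling

section Stepanov

open Polynomial WeierstrassCurve.Affine

variable {F : Type*} [Field F] {W : WeierstrassCurve.Affine F}

/-- The order of the pole at infinity of a function on an affine Weierstrass curve. -/
noncomputable def poleOrder (u : W.CoordinateRing) : WithBot ℕ := (Algebra.norm F[X] u).degree

theorem poleOrder_smul_basis (p q : F[X]) :
    poleOrder (p • (1 : W.CoordinateRing) + q • CoordinateRing.mk W X) =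
      max (2 • p.degree) (2 • q.degree + 3) :=
  CoordinateRing.degree_norm_smul_basis p q

theorem poleOrder_zero : poleOrder (0 : W.CoordinateRing) = ⊥ := by
  simpa using poleOrder_smul_basis (W := W) 0 0

theorem poleOrder_mul (u v : W.CoordinateRing) :
    poleOrder (u * v) = poleOrder u + poleOrder v := by
  simp [poleOrder, degree_mul]

theorem poleOrder_pow (u : W.CoordinateRing) (n : ℕ) :
    poleOrder (u ^ n) = n • poleOrder u := by
  simp [poleOrder, degree_pow]

theorem poleOrder_eq_bot {u : W.CoordinateRing} : poleOrder u = ⊥ ↔ u = 0 := by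
  have := Module.Free.of_basis (CoordinateRing.basis W)
  have := Module.Finite.of_basis (CoordinateRing.basis W)
  rw [poleOrder, degree_eq_bot, Algebra.norm_eq_zero_iff]

theorem poleOrder_smul_basis_le_iff (p q : F[X]) (K : ℕ) :
    poleOrder (p • (1 : W.CoordinateRing) + q • CoordinateRing.mk W X) ≤ ((2 * K + 1 : ℕ) : WithBot ℕ)
      ↔ p.degree < ((K + 1 : ℕ) : WithBot ℕ) ∧ q.degree < (K : WithBot ℕ) := by
  rw [poleOrder_smul_basis, max_le_iff]
  refine and_congr ?_ ?_
  · rcases eq_or_ne p 0 with rfl | hp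
    · simp
    · rw [degree_eq_natDegree hp, two_nsmul]
      norm_cast
      omega
  · rcases eq_or_ne q 0 with rfl | hq
    · simp
    · rw [degree_eq_natDegree hq, two_nsmul]
      norm_cast
      omega

theorem poleOrder_add_le (u v : W.CoordinateRing) :
    poleOrder (u + v) ≤ max (poleOrder u) (poleOrder v) := by
  obtain ⟨p, q, rfl⟩ := CoordinateRing.exists_smul_basis_eq u
  obtain ⟨p', q', rfl⟩ := CoordinateRing.exists_smul_basis_eq v
  have h : p • (1 : W.CoordinateRing) + q • CoordinateRing.mk W X +
      (p' • (1 : W.CoordinateRing) + q' • CoordinateRing.mk W X) =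
      (p + p') • (1 : W.CoordinateRing) + (q + q') • CoordinateRing.mk W X := by
    rw [add_smul, add_smul]; abel
  rw [h]
  simp only [poleOrder_smul_basis]
  have hm (f g : F[X]) : 2 • (f + g).degree ≤ max (2 • f.degree) (2 • g.degree) := by
    rcases le_max_iff.1 (degree_add_le f g) with h | h
    · exact le_max_of_le_left (nsmul_le_nsmul_right h 2)
    · exact le_max_of_le_right (nsmul_le_nsmul_right h 2)
  refine max_le ((hm p p').trans (max_le_max (le_max_left _ _) (le_max_left _ _))) ?_
  refine (add_le_add_left (hm q q') 3).trans ?_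
  rw [max_add]
  exact max_le_max (le_max_right _ _) (le_max_right _ _)

theorem poleOrder_neg (u : W.CoordinateRing) : poleOrder (-u) = poleOrder u := by
  obtain ⟨p, q, rfl⟩ := CoordinateRing.exists_smul_basis_eq u
  rw [neg_add, ← neg_smul, ← neg_smul, poleOrder_smul_basis, poleOrder_smul_basis, degree_neg,
    degree_neg]

theorem poleOrder_sum_le {ι : Type*} (s : Finset ι) (f : ι → W.CoordinateRing) {b : WithBot ℕ}
    (h : ∀ i ∈ s, poleOrder (f i) ≤ b) : poleOrder (∑ i ∈ s, f i) ≤ b := by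
  classical
  induction s using Finset.induction_on with
  | empty => simp [poleOrder_zero]
  | insert i s hi ih =>
    rw [sum_insert hi]
    exact (poleOrder_add_le _ _).trans (max_le (h i (mem_insert_self i s))
      (ih fun j hj => h j (mem_insert_of_mem hj)))

theorem poleOrder_sum_lt {ι : Type*} (s : Finset ι) (f : ι → W.CoordinateRing) {b : WithBot ℕ}
    (hb : b ≠ ⊥) (h : ∀ i ∈ s, poleOrder (f i) < b) : poleOrder (∑ i ∈ s, f i) < b := by
  classical
  induction s using Finset.induction_on with
  | empty => simpa [poleOrder_zero] using bot_lt_iff_ne_bot.2 hb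
  | insert i s hi ih =>
    rw [sum_insert hi]
    exact (poleOrder_add_le _ _).trans_lt (max_lt (h i (mem_insert_self i s))
      (ih fun j hj => h j (mem_insert_of_mem hj)))

variable (W) in
/-- The Riemann–Roch space of functions with pole order at most `m` at infinity. -/
noncomputable def poleSpace (m : ℕ) : Submodule F W.CoordinateRing where
  carrier := {u | poleOrder u ≤ m}
  add_mem' hu hv := (poleOrder_add_le _ _).trans (max_le hu hv)
  zero_mem' := by simp [poleOrder_zero]
  smul_mem' c u hu := by
    rw [Set.mem_ofPred_eq, ← algebraMap_smul F[X] c u, Algebra.smul_def, poleOrder_mul]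
    refine (add_le_add_left (?_ : _ ≤ (0 : WithBot ℕ)) _).trans (by simpa using hu)
    have : algebraMap F[X] W.CoordinateRing (algebraMap F F[X] c) =
        C c • (1 : W.CoordinateRing) + (0 : F[X]) • CoordinateRing.mk W X := by
      rw [zero_smul, add_zero, Algebra.algebraMap_eq_smul_one]; rfl
    rw [this, poleOrder_smul_basis]
    simp only [degree_zero, two_nsmul, WithBot.bot_add, bot_le, sup_of_le_left]
    exact add_nonpos degree_C_le degree_C_le

theorem mem_poleSpace {m : ℕ} {u : W.CoordinateRing} : u ∈ poleSpace W m ↔ poleOrder u ≤ m :=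
  Iff.rfl

theorem natCard_poleSpace [Finite F] (K : ℕ) :
    Nat.card (poleSpace W (2 * K + 1)) = Nat.card F ^ (2 * K + 1) := by
  let f : degreeLT F (K + 1) × degreeLT F K → poleSpace W (2 * K + 1) := fun p =>
    ⟨p.1.1 • (1 : W.CoordinateRing) + p.2.1 • CoordinateRing.mk W X,
      mem_poleSpace.2 ((poleOrder_smul_basis_le_iff _ _ K).2
        ⟨mem_degreeLT.1 p.1.2, mem_degreeLT.1 p.2.2⟩)⟩
  have hf : f.Bijective := by
    constructor
    · rintro ⟨⟨p, hp⟩, ⟨q, hq⟩⟩ ⟨⟨p', hp'⟩, ⟨q', hq'⟩⟩ h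
      have h' : p • (1 : W.CoordinateRing) + q • CoordinateRing.mk W X =
        p' • (1 : W.CoordinateRing) + q' • CoordinateRing.mk W X := congrArg Subtype.val h
      have h0 : (p - p') • (1 : W.CoordinateRing) + (q - q') • CoordinateRing.mk W X = 0 := by
        rw [sub_smul, sub_smul, sub_add_sub_comm, h', sub_self]
      obtain ⟨h1, h2⟩ := CoordinateRing.smul_basis_eq_zero h0
      simp only [Prod.mk.injEq, Subtype.mk.injEq]
      exact ⟨sub_eq_zero.1 h1, sub_eq_zero.1 h2⟩
    · rintro ⟨u, hu⟩
      obtain ⟨p, q, rfl⟩ := CoordinateRing.exists_smul_basis_eq u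
      have := (poleOrder_smul_basis_le_iff p q K).1 (mem_poleSpace.1 hu)
      exact ⟨⟨⟨p, mem_degreeLT.2 this.1⟩, ⟨q, mem_degreeLT.2 this.2⟩⟩, rfl⟩
  have hc (n : ℕ) : Nat.card (degreeLT F n) = Nat.card F ^ n := by
    rw [Nat.card_congr (degreeLTEquiv F n).toEquiv, Nat.card_fun, Nat.card_fin]
  rw [← Nat.card_congr (Equiv.ofBijective f hf), Nat.card_prod, hc, hc, ← pow_add]
  congr 1
  ring

theorem exists_poleOrder_eq {m : ℕ} (hm : m ≠ 1) : ∃ u : W.CoordinateRing, poleOrder u = m := by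
  rcases Nat.even_or_odd' m with ⟨j, rfl | rfl⟩
  · refine ⟨(X ^ j : F[X]) • 1 + (0 : F[X]) • CoordinateRing.mk W X, ?_⟩
    rw [poleOrder_smul_basis, degree_X_pow]
    simp [two_mul]
  · refine ⟨(0 : F[X]) • 1 + (X ^ (j - 1) : F[X]) • CoordinateRing.mk W X, ?_⟩
    rw [poleOrder_smul_basis, degree_X_pow]
    simp only [degree_zero, two_nsmul, WithBot.bot_add, bot_le, sup_of_le_right]
    norm_cast
    omega

/-- The auxiliary relation in Stepanov's method: a nontrivial `Q`-Frobenius-semilinear relation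
between functions of small pole order, obtained by counting. -/
theorem exists_sum_pow_mul_eq_zero [Finite F] [CharP F 2] {k e : ℕ} (hk : 1 ≤ k)
    (he : 2 * (k + 1) = 2 ^ e) (t : Fin (2 * k + 5) → W.CoordinateRing)
    (ht : ∀ i, poleOrder (t i) ≤ ((2 * k + 5 : ℕ) : WithBot ℕ)) :
    ∃ s : Fin (2 * k + 5) → poleSpace W (2 * k + 1), s ≠ 0 ∧
      ∑ i, (s i : W.CoordinateRing) ^ (2 * (k + 1)) * t i = 0 := by
  have : CharP W.CoordinateRing 2 :=
    charP_of_injective_algebraMap (FaithfulSMul.algebraMap_injective F W.CoordinateRing) 2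
  let Z : (Fin (2 * k + 5) → poleSpace W (2 * k + 1)) →
      poleSpace W (2 * (2 * (k + 1) ^ 2 + 1) + 1) := fun s =>
    ⟨∑ i, (s i : W.CoordinateRing) ^ (2 * (k + 1)) * t i, by
      refine mem_poleSpace.2 (poleOrder_sum_le _ _ fun i _ => ?_)
      rw [poleOrder_mul, poleOrder_pow]
      refine (add_le_add (nsmul_le_nsmul_right (mem_poleSpace.1 (s i).2) _) (ht i)).trans ?_
      rw [nsmul_eq_mul]
      norm_cast
      nlinarith⟩
  have hfin (m : ℕ) : Finite (poleSpace W (2 * m + 1)) :=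
    Nat.finite_of_card_ne_zero (by rw [natCard_poleSpace]; exact (pow_pos Nat.card_pos _).ne')
  have := hfin k
  have := hfin (2 * (k + 1) ^ 2 + 1)
  have hZ : ¬ Z.Injective := by
    intro h
    have h1 := Nat.card_le_card_of_injective Z h
    rw [Nat.card_fun, natCard_poleSpace, natCard_poleSpace, Nat.card_fin, ← pow_mul,
      Nat.pow_le_pow_iff_right Finite.one_lt_card] at h1
    nlinarith
  obtain ⟨s, s', hs, hne⟩ : ∃ s s', Z s = Z s' ∧ s ≠ s' := by
    simpa [Function.Injective] using hZ
  refine ⟨s - s', sub_ne_zero.2 hne, ?_⟩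
  have h := congrArg Subtype.val hs
  rw [← sub_eq_zero] at h
  rw [← h, ← sum_sub_distrib]
  refine sum_congr rfl fun i _ => ?_
  rw [Pi.sub_apply, Submodule.coe_sub, he, sub_pow_char_pow, sub_mul]

theorem sum_mul_pow_ne_zero {k : ℕ} {ι : Type*} [Fintype ι] {t s : ι → W.CoordinateRing}
    {o : ι → ℕ} (ho : o.Injective) (ht : ∀ i, poleOrder (t i) = o i) (hs0 : s ≠ 0)
    (hs : ∀ i, poleOrder (s i) ≤ (k : WithBot ℕ)) : ∑ i, s i * t i ^ (k + 1) ≠ 0 := by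
  classical
  obtain ⟨j, hj⟩ := Function.ne_iff.1 hs0
  obtain ⟨i, hi, hmax⟩ := exists_max_image ({i | s i ≠ 0} : Finset ι) o ⟨j, by simpa using hj⟩
  have hi : s i ≠ 0 := by simpa using hi
  have hord (j) : poleOrder (s j * t j ^ (k + 1)) = poleOrder (s j) + ((k + 1) * o j : ℕ) := by
    rw [poleOrder_mul, poleOrder_pow, ht]
    simp
  have hbig : (((k + 1) * o i : ℕ) : WithBot ℕ) ≤ poleOrder (s i * t i ^ (k + 1)) := by
    rw [hord]
    obtain ⟨n, hn⟩ := WithBot.ne_bot_iff_exists.1 (mt poleOrder_eq_bot.1 hi)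
    rw [← hn]
    exact le_add_of_nonneg_left (WithBot.coe_le_coe.2 n.zero_le)
  have hrest : poleOrder (∑ j ∈ univ.erase i, s j * t j ^ (k + 1)) <
      (((k + 1) * o i : ℕ) : WithBot ℕ) := by
    refine poleOrder_sum_lt _ _ (WithBot.natCast_ne_bot _) fun j hj => ?_
    rw [hord]
    by_cases h0 : s j = 0
    · rw [h0, poleOrder_zero, WithBot.bot_add]
      exact WithBot.bot_lt_coe _
    · have hlt : o j < o i := lt_of_le_of_ne (hmax j (by simpa using h0))
        (ho.ne (ne_of_mem_erase hj))
      refine (add_le_add_left (hs j) _).trans_lt ?_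
      norm_cast
      nlinarith
  intro h
  rw [← add_sum_erase _ _ (mem_univ i), add_eq_zero_iff_eq_neg] at h
  rw [h, poleOrder_neg] at hbig
  exact absurd hbig (not_le.2 hrest)

/-- Stepanov's bound for the number of `x` over which there are two rational points. -/
theorem card_le_of_two_points [Fintype F] [CharP F 2] {k e : ℕ} (hk : 1 ≤ k)
    (he : 2 * (k + 1) = 2 ^ e) (hF : Fintype.card F = (2 * (k + 1)) ^ 2) (S : Finset F)
    (hS : ∀ x ∈ S, ∃ y z, y ≠ z ∧ W.Equation x y ∧ W.Equation x z) :
    #S ≤ 2 * k ^ 2 + 8 * k + 5 := by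
  let o (i : Fin (2 * k + 5)) : ℕ := (1 : Fin (2 * k + 6)).succAbove i
  have ho : o.Injective := Fin.val_injective.comp Fin.succAbove_right_injective
  have ho1 (i) : o i ≠ 1 := fun h => Fin.succAbove_ne 1 i (Fin.ext h)
  have hole (i) : o i ≤ 2 * k + 5 := Nat.le_of_lt_succ ((1 : Fin (2 * k + 6)).succAbove i).2
  choose t ht using fun i => exists_poleOrder_eq (W := W) (ho1 i)
  obtain ⟨s, hs0, hs⟩ := exists_sum_pow_mul_eq_zero hk he t
    fun i => (ht i).le.trans (by exact_mod_cast hole i)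
  set U := ∑ i, (s i : W.CoordinateRing) * t i ^ (2 * k + 1 + 1) with hU
  have hU0 : U ≠ 0 := sum_mul_pow_ne_zero ho ht
    (fun h => hs0 (funext fun i => Subtype.ext (congrFun h i))) fun i => mem_poleSpace.1 (s i).2
  have hUle : poleOrder U ≤ ((2 * (2 * k ^ 2 + 8 * k + 5) + 1 : ℕ) : WithBot ℕ) := by
    refine poleOrder_sum_le _ _ fun i _ => ?_
    rw [poleOrder_mul, poleOrder_pow, ht]
    refine (add_le_add_left (mem_poleSpace.1 (s i).2) _).trans ?_
    rw [nsmul_eq_mul]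
    norm_cast
    nlinarith [hole i]
  have hev {x y : F} (h : W.Equation x y) : AdjoinRoot.evalEval h U = 0 := by
    refine eq_zero_of_pow_eq_zero (n := 2 * (k + 1)) ?_
    have := congrArg (AdjoinRoot.evalEval h) hs
    rw [map_zero] at this
    rw [← this, hU, map_sum, map_sum, he, sum_pow_char_pow]
    refine sum_congr rfl fun i _ => ?_
    rw [map_mul, map_mul, map_pow, map_pow, mul_pow, ← pow_mul, ← he,
      show (2 * k + 1 + 1) * (2 * (k + 1)) = Fintype.card F by rw [hF]; ring, FiniteField.pow_card]
  obtain ⟨A, B, hAB⟩ := CoordinateRing.exists_smul_basis_eq U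
  have hzero (x) (hx : x ∈ S) : A.eval x = 0 ∧ B.eval x = 0 := by
    obtain ⟨y, z, hyz, hy, hz⟩ := hS x hx
    have hval {y : F} (h : W.Equation x y) : A.eval x + B.eval x * y = 0 := by
      rw [← hev h, ← hAB, map_add, CoordinateRing.smul, CoordinateRing.smul, mul_one, map_mul]
      erw [AdjoinRoot.evalEval_mk, AdjoinRoot.evalEval_mk, AdjoinRoot.evalEval_mk]
      simp [evalEval]
    have hB : B.eval x = 0 := by
      have := (hval hy).trans (hval hz).symm
      rw [add_right_inj, mul_eq_mul_left_iff] at this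
      exact this.resolve_left hyz
    exact ⟨by simpa [hB] using hval hy, hB⟩
  rw [← hAB, poleOrder_smul_basis_le_iff] at hUle
  have hcard {P : F[X]} (hP : P ≠ 0) (hPS : ∀ x ∈ S, P.eval x = 0) : #S ≤ P.natDegree :=
    card_le_degree_of_subset_roots fun x hx => (mem_roots hP).2 (hPS x hx)
  by_cases hA : A = 0
  · have hB : B ≠ 0 := by
      rintro rfl
      exact hU0 (by rw [← hAB, hA]; simp)
    have := (natDegree_lt_iff_degree_lt hB).2 hUle.2
    have := hcard hB fun x hx => (hzero x hx).2
    omega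
  · have := (natDegree_lt_iff_degree_lt hA).2 hUle.1
    have := hcard hA fun x hx => (hzero x hx).1
    omega

end Stepanov

section HasseBound

/-- The additive form of Hilbert's Theorem 90 for the Frobenius over `𝔽₂`. -/
theorem exists_sq_add_eq {F : Type*} [Field F] [Finite F] [Algebra (ZMod 2) F] {z : F}
    (hz : Algebra.trace (ZMod 2) F z = 0) : ∃ y, y ^ 2 + y = z := by
  have : CharP F 2 := charP_of_injective_algebraMap (algebraMap (ZMod 2) F).injective 2
  let f : F →ₗ[ZMod 2] F := (frobeniusEquiv F 2).toAddMonoidHom.toZModLinearMap 2 + LinearMap.id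
  have hf (y) : f y = y ^ 2 + y := rfl
  have hle : f.range ≤ (Algebra.trace (ZMod 2) F).ker := by
    rintro _ ⟨y, rfl⟩
    have h : Algebra.trace (ZMod 2) F (y ^ 2) = Algebra.trace (ZMod 2) F y := by
      have := Algebra.trace_eq_of_algEquiv (FiniteField.frobeniusAlgEquivOfAlgebraic (ZMod 2) F) y
      simpa using this
    rw [LinearMap.mem_ker, hf, map_add, h, CharTwo.add_self_eq_zero]
  have hker : Module.finrank (ZMod 2) f.ker ≤ 1 := by
    refine finrank_le_one ⟨1, by simp [LinearMap.mem_ker, hf, CharTwo.add_self_eq_zero]⟩ ?_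
    rintro ⟨y, hy⟩
    rw [LinearMap.mem_ker, hf, show y ^ 2 + y = y * (y + 1) by ring, mul_eq_zero] at hy
    rcases hy with rfl | hy
    · exact ⟨0, by ext; simp⟩
    · exact ⟨1, by ext; simp [CharTwo.add_eq_zero.1 hy]⟩
  have h1 := f.finrank_range_add_finrank_ker
  have h2 := (Algebra.trace (ZMod 2) F).finrank_range_add_finrank_ker
  rw [LinearMap.range_eq_top.2 (Algebra.trace_surjective (ZMod 2) F), finrank_top,
    Module.finrank_self] at h2
  have heq : f.range = (Algebra.trace (ZMod 2) F).ker :=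
    Submodule.eq_of_le_of_finrank_le hle (by omega)
  exact heq.ge (LinearMap.mem_ker.2 hz)

theorem neg_four_mul_le_klSum {F : Type*} [Field F] [Fintype F] [Algebra (ZMod 2) F] {e : ℕ}
    (he : 2 ≤ e) (hF : Fintype.card F = (2 ^ e) ^ 2) (c : F) : -4 * 2 ^ e ≤ klSum c - 1 := by
  have : CharP F 2 := charP_of_injective_algebraMap (algebraMap (ZMod 2) F).injective 2
  obtain ⟨e, rfl⟩ := Nat.exists_eq_add_of_le' he
  obtain ⟨k, hk⟩ : ∃ k, 2 * (k + 1) = 2 ^ (e + 2) :=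
    ⟨2 ^ (e + 1) - 1, by rw [Nat.sub_add_cancel Nat.one_le_two_pow]; ring⟩
  have hk1 : 1 ≤ k := by
    have : 1 ≤ 2 ^ e := Nat.one_le_two_pow
    rw [pow_add] at hk
    omega
  obtain ⟨δ, hδ⟩ := Algebra.trace_surjective (ZMod 2) F 1
  have hS := card_le_of_two_points (W := ⟨1, δ, 0, c, 0⟩) hk1 hk (by rw [hF, hk])
    {x : F | signChar F (x + c * x⁻¹) = -1} fun x hx => by
      rw [mem_filter_univ] at hx
      have hx0 : x ≠ 0 := by
        rintro rfl
        norm_num at hx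
      have htr : Algebra.trace (ZMod 2) F (x + δ + c * x⁻¹) = 0 := by
        have h1 : Algebra.trace (ZMod 2) F (x + c * x⁻¹) ≠ 0 := fun h => by
          rw [signChar_eq_one_iff.2 h] at hx
          norm_num at hx
        rw [show x + δ + c * x⁻¹ = x + c * x⁻¹ + δ by ring, map_add, hδ]
        revert h1
        generalize Algebra.trace (ZMod 2) F (x + c * x⁻¹) = u
        revert u
        decide
      obtain ⟨z, hz⟩ := exists_sq_add_eq htr
      have hz' : x * (z ^ 2 + z) = x ^ 2 + δ * x + c := by rw [hz]; field_simp
      refine ⟨x * z, x * z + x, by simpa using hx0, ?_, ?_⟩ <;>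
        rw [WeierstrassCurve.Affine.equation_iff]
      · linear_combination x * hz'
      · linear_combination x * hz' + (x ^ 2 * z + x ^ 2) * CharTwo.two_eq_zero (R := F)
  rw [klSum_eq_card_sub, hF, ← hk]
  have hk' : (2 : ℤ) ^ (e + 2) = 2 * (k + 1) := by exact_mod_cast hk.symm
  rw [hk']
  zify at hS
  push_cast
  linarith

/-- A bound for Kloosterman sums over all fields of characteristic `2` that is weaker than
Hasse's by the constant factor `C`. -/
def HasseBoundUpTo (C : ℝ) : Prop :=
  ∀ (F : Type) [Field F] [Fintype F] [Algebra (ZMod 2) F] (a : F), a ≠ 0 →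
    ((klSum a - 1 : ℤ) : ℝ) ^ 2 ≤ 4 * C * Fintype.card F

theorem exists_klSum_sq_eq {F : Type*} [Field F] [Fintype F] [Algebra (ZMod 2) F] {a : F}
    (ha : a ≠ 0) : ∃ (E : Type) (_ : Field E) (_ : Fintype E) (_ : Algebra (ZMod 2) E) (b : E),
      b ≠ 0 ∧ Fintype.card E = Fintype.card F ^ 2 ∧
      (klSum a - 1) ^ 2 = 2 * Fintype.card F - (klSum b - 1) := by
  have : CharP F 2 := charP_of_injective_algebraMap (algebraMap (ZMod 2) F).injective 2
  have := Fintype.ofFinite (FiniteField.Extension F 2 2)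
  refine ⟨FiniteField.Extension F 2 2, inferInstance, this, inferInstance, algebraMap F _ a,
    by simpa using ha, ?_, ?_⟩
  · simpa [Nat.card_eq_fintype_card] using FiniteField.natCard_extension F 2 2
  · rw [klSum_quadratic_extension (FiniteField.finrank_extension F 2 2) ha]
    ring

theorem hasseBoundUpTo_two : HasseBoundUpTo 2 := by
  intro F _ _ _ a ha
  have : CharP F 2 := charP_of_injective_algebraMap (algebraMap (ZMod 2) F).injective 2
  rcases lt_or_ge (Fintype.card F) 4 with hq | hq
  · have h1 := klSum_eq_card_sub a
    have h2 := card_le_univ ({x : F | signChar F (x + a * x⁻¹) = -1} : Finset F)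
    have h3 : 2 ≤ Fintype.card F := Fintype.one_lt_card
    generalize #({x : F | signChar F (x + a * x⁻¹) = -1} : Finset F) = m at h1 h2
    rw [h1]
    generalize Fintype.card F = q at *
    push_cast
    have h2' : (m : ℝ) ≤ q := by exact_mod_cast h2
    have h3' : (2 : ℝ) ≤ q := by exact_mod_cast h3
    have h4' : (q : ℝ) ≤ 4 := by exact_mod_cast hq.le
    have h5' : (0 : ℝ) ≤ m := m.cast_nonneg
    nlinarith [mul_nonneg h5' (sub_nonneg.2 h2')]
  · obtain ⟨n, -, hn⟩ := FiniteField.card F 2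
    obtain ⟨E, _, _, _, b, hb, hE, h⟩ := exists_klSum_sq_eq ha
    have hn2 : 2 ≤ (n : ℕ) := by
      by_contra! h
      have : (2 : ℕ) ^ (n : ℕ) ≤ 2 ^ 1 := Nat.pow_le_pow_right two_pos (by omega)
      omega
    have h1 := neg_four_mul_le_klSum hn2 (hE.trans (by rw [hn])) b
    have h2 : (Fintype.card F : ℤ) = 2 ^ (n : ℕ) := by exact_mod_cast hn
    rw [← h2] at h1
    have h3 : (klSum a - 1) ^ 2 ≤ 8 * (Fintype.card F : ℤ) := by linarith
    norm_num
    exact_mod_cast h3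

theorem HasseBoundUpTo.improve {C : ℝ} (hC : HasseBoundUpTo C) (hC1 : 1 ≤ C) :
    HasseBoundUpTo (1 + (C - 1) / 4) := by
  intro F _ _ _ a ha
  obtain ⟨E, _, _, _, b, hb, hE, h⟩ := exists_klSum_sq_eq ha
  have h1 := hC E b hb
  have h2 : ((klSum a - 1 : ℤ) : ℝ) ^ 2 = 2 * Fintype.card F - (klSum b - 1 : ℤ) := by
    exact_mod_cast h
  rw [hE] at h1
  push_cast at h1 h2 ⊢
  have h3 : (klSum b - 1 : ℝ) ^ 2 ≤ ((1 + C) * Fintype.card F) ^ 2 := by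
    nlinarith [sq_nonneg ((1 - C) * (Fintype.card F : ℝ))]
  have h4 := (abs_le_of_sq_le_sq' h3 (by positivity)).1
  linarith

theorem hasseBoundUpTo_one : HasseBoundUpTo 1 := by
  have h (m : ℕ) : HasseBoundUpTo (1 + (1 / 4) ^ m) := by
    induction m with
    | zero => norm_num; exact hasseBoundUpTo_two
    | succ m ih =>
      have := ih.improve (by simp)
      rwa [show 1 + (1 + (1 / 4 : ℝ) ^ m - 1) / 4 = 1 + (1 / 4) ^ (m + 1) by ring] at this
  intro F _ _ _ a ha
  have hlim : Filter.Tendsto (fun m : ℕ => 4 * (1 + (1 / 4 : ℝ) ^ m) * Fintype.card F)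
      Filter.atTop (nhds (4 * (1 + 0) * Fintype.card F)) :=
    ((tendsto_pow_atTop_nhds_zero_of_lt_one (by norm_num) (by norm_num)).const_add 1
      |>.const_mul 4).mul_const _
  rw [add_zero] at hlim
  exact ge_of_tendsto' hlim fun m => h m F a ha

/-- Hasse's bound for Kloosterman sums in characteristic `2`. -/
theorem klSum_sub_one_sq_le {F : Type*} [Field F] [Fintype F] [Algebra (ZMod 2) F] {a : F}
    (ha : a ≠ 0) : (klSum a - 1) ^ 2 ≤ 4 * Fintype.card F := by
  obtain ⟨E, _, _, _, b, hb, hE, h⟩ := exists_klSum_sq_eq ha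
  have h1 : (klSum b - 1) ^ 2 ≤ (2 * (Fintype.card F : ℤ)) ^ 2 := by
    have := hasseBoundUpTo_one E b hb
    rw [hE] at this
    have : (klSum b - 1) ^ 2 ≤ 4 * 1 * ((Fintype.card F ^ 2 : ℕ) : ℤ) := by exact_mod_cast this
    push_cast at this
    linarith
  have h2 := (abs_le_of_sq_le_sq' h1 (by positivity)).1
  linarith

end HasseBound

section Theta

open Complex Filter Topology
open scoped Real

theorem hasSum_jacobiTheta₂_term_mul {τ : ℂ} (hτ : 0 < τ.im) (z w : ℂ) :
    HasSum (fun p : ℤ × ℤ => jacobiTheta₂_term p.1 z τ * jacobiTheta₂_term p.2 w τ)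
      (jacobiTheta₂ z τ * jacobiTheta₂ w τ) := by
  have hz := hasSum_jacobiTheta₂_term z hτ
  have hw := hasSum_jacobiTheta₂_term w hτ
  have hz' := hz.summable.norm
  have hw' := hw.summable.norm
  have hzw := summable_mul_of_summable_norm hz' hw'
  have h := HasSum.mul hz hw hzw
  exact h

/-- The duplication formula for theta functions. -/
theorem jacobiTheta₂_duplication (z : ℂ) {τ : ℂ} (hτ : 0 < τ.im) :
    jacobiTheta₂ z τ * jacobiTheta₂ 0 τ + jacobiTheta₂ (z + 1 / 2) τ * jacobiTheta₂ (1 / 2) τ =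
      2 * jacobiTheta₂ z (2 * τ) ^ 2 := by
  have h2τ : 0 < (2 * τ).im := by simpa using hτ
  let e : ℤ × ℤ → ℤ × ℤ := fun p => (p.1 + p.2, p.1 - p.2)
  have he : e.Injective := by
    rintro ⟨a, b⟩ ⟨a', b'⟩ h
    simp only [e, Prod.mk.injEq] at h ⊢
    omega
  have hterm (m n : ℤ) :
      jacobiTheta₂_term m z τ * jacobiTheta₂_term n 0 τ +
        jacobiTheta₂_term m (z + 1 / 2) τ * jacobiTheta₂_term n (1 / 2) τ =
      (1 + (-1) ^ (m + n)) * (jacobiTheta₂_term m z τ * jacobiTheta₂_term n 0 τ) := by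
    have hsgn : jacobiTheta₂_term m (z + 1 / 2) τ * jacobiTheta₂_term n (1 / 2) τ =
        (-1) ^ (m + n) * (jacobiTheta₂_term m z τ * jacobiTheta₂_term n 0 τ) := by
      rw [← exp_pi_mul_I, ← exp_int_mul]
      simp only [jacobiTheta₂_term, ← Complex.exp_add]
      congr 1
      push_cast
      ring
    rw [hsgn]
    ring
  have h1 := (hasSum_jacobiTheta₂_term_mul hτ z 0).add (hasSum_jacobiTheta₂_term_mul hτ (z + 1 / 2) (1 / 2))
  simp only [hterm] at h1
  rw [← he.hasSum_iff] at h1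
  · refine h1.unique ?_
    rw [pow_two]
    refine ((hasSum_jacobiTheta₂_term_mul h2τ z z).mul_left 2).congr_fun fun ⟨a, b⟩ => ?_
    simp only [Function.comp_apply, e]
    rw [show a + b + (a - b) = 2 * a by ring, zpow_mul]
    norm_num
    simp only [jacobiTheta₂_term, ← Complex.exp_add]
    congr 1
    push_cast
    ring
  · rintro ⟨m, n⟩ hmn
    have hodd : Odd (m + n) := by
      rw [← Int.not_even_iff_odd]
      rintro ⟨r, hr⟩
      exact hmn ⟨(r, m - r), by simp only [e, Prod.mk.injEq]; omega⟩
    simp [hodd.neg_one_zpow]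

theorem jacobiTheta₂_functional_equation_sq (z : ℂ) {τ : ℂ} (hτ : 0 < τ.im) :
    -I * τ * jacobiTheta₂ z τ ^ 2 =
      cexp (-2 * π * I * z ^ 2 / τ) * jacobiTheta₂ (z / τ) (-1 / τ) ^ 2 := by
  have hτ0 : τ ≠ 0 := by rintro rfl; simp at hτ
  have h0 : -I * τ ≠ 0 := mul_ne_zero (neg_ne_zero.2 I_ne_zero) hτ0
  have hs : ((-I * τ) ^ (1 / 2 : ℂ)) ^ 2 = -I * τ := by
    rw [← cpow_nat_mul]
    norm_num
  have hs0 : (-I * τ) ^ (1 / 2 : ℂ) ≠ 0 := by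
    intro h
    rw [h] at hs
    exact h0 (by rw [← hs]; norm_num)
  rw [jacobiTheta₂_functional_equation z τ, mul_pow, mul_pow, ← Complex.exp_nat_mul, div_pow, hs,
    one_pow, show ((2 : ℕ) : ℂ) * (-π * I * z ^ 2 / τ) = -2 * π * I * z ^ 2 / τ by push_cast; ring]
  field_simp

theorem jacobiTheta₂_add_two_mul_int (z τ : ℂ) (c : ℤ) :
    jacobiTheta₂ z (τ + 2 * c) = jacobiTheta₂ z τ := by
  have h : Function.Periodic (jacobiTheta₂ z) 2 := jacobiTheta₂_add_right z
  simpa [mul_comm] using h.int_mul c τ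

theorem jacobiTheta₂_add_int (z τ : ℂ) (c : ℤ) : jacobiTheta₂ (z + c) τ = jacobiTheta₂ z τ := by
  have h : Function.Periodic (jacobiTheta₂ · τ) 1 := fun z => jacobiTheta₂_add_left z τ
  simpa using h.int_mul c z

/-- Transformation of squares of theta constants under the lower triangular subgroup
of `Γ(2)`. -/
theorem jacobiTheta₂_sq_div {z τ : ℂ} (hτ : 0 < τ.im) {c m : ℤ} (hz : 2 * c * z = m)
    (hσ : 0 < (τ / (2 * c * τ + 1)).im) :
    jacobiTheta₂ z (τ / (2 * c * τ + 1)) ^ 2 =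
      (2 * c * τ + 1) * cexp (-2 * π * I * m * z) * jacobiTheta₂ z τ ^ 2 := by
  have hτ0 : τ ≠ 0 := by rintro rfl; simp at hτ
  have hd : 2 * c * τ + 1 ≠ 0 := by
    intro h
    simp [h] at hσ
  have h1 := jacobiTheta₂_functional_equation_sq z hτ
  have h2 := jacobiTheta₂_functional_equation_sq z hσ
  rw [show z / (τ / (2 * c * τ + 1)) = z / τ + m by rw [← hz]; field_simp; ring,
    show -1 / (τ / (2 * c * τ + 1)) = -1 / τ + 2 * (-c : ℤ) by push_cast; field_simp; ring,
    jacobiTheta₂_add_int, jacobiTheta₂_add_two_mul_int,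
    show -2 * π * I * z ^ 2 / (τ / (2 * c * τ + 1)) =
      -2 * π * I * z ^ 2 / τ + -2 * π * I * m * z by rw [← hz]; field_simp; ring,
    Complex.exp_add] at h2
  have h0 : -I * τ ≠ 0 := mul_ne_zero (neg_ne_zero.2 I_ne_zero) hτ0
  refine mul_left_cancel₀ h0 ?_
  linear_combination (2 * c * τ + 1) * h2
    - (2 * c * τ + 1) * cexp (-2 * π * I * m * z) * h1
    + I * jacobiTheta₂ z (τ / (2 * c * τ + 1)) ^ 2 * mul_div_cancel₀ τ hd

theorem jacobiTheta₂_half (τ : ℂ) : jacobiTheta₂ (1 / 2) τ = jacobiTheta (τ + 1) := by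
  rw [jacobiTheta_eq_jacobiTheta₂]
  refine tsum_congr fun n => ?_
  rw [jacobiTheta₂_term, jacobiTheta₂_term, Complex.exp_eq_exp_iff_exists_int]
  obtain ⟨r, hr⟩ := Int.even_mul_pred_self n
  refine ⟨-r, ?_⟩
  have hr' : (n : ℂ) * (n - 1) = r + r := by exact_mod_cast hr
  push_cast
  linear_combination (-(π * I)) * hr'

theorem tendsto_jacobiTheta_two_pow_mul {τ : ℂ} (hτ : 0 < τ.im) (x : ℝ) :
    Tendsto (fun k : ℕ => jacobiTheta (2 ^ k * τ + x)) atTop (𝓝 1) := by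
  have him (k : ℕ) : (2 ^ k * τ + x).im = 2 ^ k * τ.im := by
    have : ((2 : ℂ) ^ k) = ((2 ^ k : ℝ) : ℂ) := by push_cast; rfl
    rw [this, add_im, im_ofReal_mul, ofReal_im, add_zero]
  have h1 : Tendsto (fun k : ℕ => (2 ^ k * τ + x).im) atTop atTop := by
    simp only [him]
    exact (tendsto_pow_atTop_atTop_of_one_lt one_lt_two).atTop_mul_const hτ
  have h2 := isBigO_at_im_infty_jacobiTheta_sub_one.comp_tendsto (tendsto_comap_iff.2 h1)
  have h3 : Tendsto (fun y : ℝ => rexp (-π * y)) atTop (𝓝 0) :=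
    Real.tendsto_exp_atBot.comp (tendsto_id.const_mul_atTop_of_neg (neg_lt_zero.2 Real.pi_pos))
  have h4 := h2.trans_tendsto (h3.comp h1)
  simpa using h4.add_const 1

end Theta

section LandenCycle

/-- A cycle of `n` moduli under Landen's transformation, with multiplier `w`. -/
structure IsLandenCycle {K : Type*} [Field K] (n : ℕ) (l : ℕ → K) (w : K) : Prop where
  periodic : Function.Periodic l n
  landen : ∀ k, l (k + 1) ^ 2 * (1 + l k) ^ 2 = 4 * l k
  ne_one : ∀ k, l k ≠ 1
  prod_eq : ∏ k ∈ range n, (1 + l k) = w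

theorem IsLandenCycle.map {K L : Type*} [Field K] [Field L] {n : ℕ} {l : ℕ → K} {w : K}
    (h : IsLandenCycle n l w) (f : K →+* L) : IsLandenCycle n (f ∘ l) (f w) where
  periodic := h.periodic.comp f
  landen k := by simpa [map_ofNat] using congrArg f (h.landen k)
  ne_one k := by simpa using f.injective.ne (h.ne_one k)
  prod_eq := by simpa using congrArg f h.prod_eq

/-- The ratios of an arithmetic-geometric sequence that returns to its initial values up to a
factor form a cycle. -/
theorem isLandenCycle_of_agm {a b : ℕ → ℂ} {u : ℂ} {n : ℕ} (hn : n ≠ 0)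
    (ha : ∀ k, 2 * a (k + 1) = a k + b k) (hb : ∀ k, b (k + 1) ^ 2 = a k * b k)
    (hlim : Filter.Tendsto b Filter.atTop (nhds 1))
    (han : a n = u * a 0) (hbn : b n ^ 2 = u ^ 2 * b 0 ^ 2) (hu : u ≠ 1) :
    IsLandenCycle n (fun k => b (k % n) / a (k % n)) (2 ^ n * u) := by
  have hb0 (k) : b k ≠ 0 := by
    intro h
    have h0 (m) : b (k + m) = 0 := by
      induction m with
      | zero => exact h
      | succ m ih => simpa [ih, ← add_assoc] using hb (k + m)
    have h1 : Filter.Tendsto (fun m => b (m + k)) Filter.atTop (nhds 1) :=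
      hlim.comp (Filter.tendsto_add_atTop_nat k)
    simp only [add_comm _ k, h0] at h1
    exact zero_ne_one (tendsto_nhds_unique tendsto_const_nhds h1)
  have ha0 (k) : a k ≠ 0 := by
    intro h
    exact hb0 (k + 1) (by simpa [h] using hb k)
  have hsub (k) : (a k - b k) ^ 2 = 4 * ((a (k + 1) - b (k + 1)) * (a (k + 1) + b (k + 1))) := by
    linear_combination (-(2 * a (k + 1)) - a k - b k) * ha k + 4 * hb k
  have hback (k) (h : a k = b k) : a 0 = b 0 := by
    induction k with
    | zero => exact h
    | succ k ih =>
      have := hsub k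
      rw [h, sub_self, zero_mul, mul_zero] at this
      exact ih (sub_eq_zero.1 (eq_zero_of_pow_eq_zero this))
  have hne (k) : a k ≠ b k := by
    intro h
    have h0 := hback k h
    have hconst (m) : a m = a 0 ∧ b m = a 0 := by
      induction m with
      | zero => exact ⟨rfl, h0.symm⟩
      | succ m ih =>
        have h1 : a (m + 1) = a 0 := by linear_combination (ha m + ih.1 + ih.2) / 2
        have h2 := hsub m
        rw [ih.1, ih.2, sub_self, zero_pow two_ne_zero, eq_comm, mul_eq_zero, mul_eq_zero] at h2
        refine ⟨h1, ?_⟩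
        rcases h2 with h2 | h2 | h2
        · norm_num at h2
        · rw [← h1, sub_eq_zero.1 h2]
        · exact absurd (by simpa [h2] using ha (m + 1)) (ha0 (m + 1 + 1))
    rw [(hconst n).1] at han
    exact hu (mul_right_cancel₀ (ha0 0) (by rw [← han, one_mul]))
  have hrel (k) : (b (k + 1) / a (k + 1)) ^ 2 * (1 + b k / a k) ^ 2 = 4 * (b k / a k) := by
    have := ha0 k
    have := ha0 (k + 1)
    have h1 : 1 + b k / a k = 2 * a (k + 1) / a k := by rw [ha]; field_simp
    rw [h1, div_pow, div_pow, hb]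
    field_simp
    norm_num
  refine ⟨fun k => by simp, fun k => ?_, fun k h => hne (k % n) (div_eq_one_iff_eq (ha0 _) |>.1 h).symm, ?_⟩
  · have hk := Nat.mod_lt k (Nat.pos_of_ne_zero hn)
    rw [← hrel (k % n)]
    congr 1
    rcases (Nat.succ_le_of_lt hk).lt_or_eq with h | h
    · rw [Nat.add_mod, Nat.mod_eq_of_lt (a := 1) (by omega), Nat.mod_eq_of_lt h]
    · have h1 : (k + 1) % n = 0 := by
        rw [← Nat.mod_add_mod, ← Nat.succ_eq_add_one, h, Nat.mod_self]
      have hu0 : u ≠ 0 := by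
        rintro rfl
        exact ha0 n (by rw [han, zero_mul])
      rw [h1, ← Nat.succ_eq_add_one, h, div_pow, div_pow, han, hbn, mul_pow,
        mul_div_mul_left _ _ (pow_ne_zero 2 hu0)]
  · have hp (m) : ∏ k ∈ range m, (1 + b k / a k) = 2 ^ m * (a m / a 0) := by
      induction m with
      | zero => simp [ha0]
      | succ m ih =>
        have := ha0 m
        have := ha0 0
        rw [prod_range_succ, ih, pow_succ]
        field_simp
        rw [ha]
    rw [prod_congr rfl fun k hk => by rw [Nat.mod_eq_of_lt (mem_range.1 hk)], hp, han,
      mul_div_cancel_right₀ _ (ha0 0)]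

/-- A quadratic irrationality of the required discriminant in the upper half-plane. -/
theorem exists_upperHalfPlane_root {q t c : ℝ} (hc : c < 0) (h : t ^ 2 < 4 * q)
    (htc : 2 * c = t - 1 - q) :
    ∃ τ : ℂ, 0 < τ.im ∧ q * τ * (c * τ + 1) = 2 * (c * τ + 1) + τ := by
  have hq : 0 < q := by nlinarith [sq_nonneg t]
  obtain ⟨s, hs0, hs⟩ : ∃ s, 0 < s ∧ s ^ 2 = 4 * q - t ^ 2 :=
    ⟨_, Real.sqrt_pos.2 (sub_pos.2 h), Real.sq_sqrt (sub_pos.2 h).le⟩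
  refine ⟨⟨-(2 * q - t) / (2 * q * c), s / (-(2 * q * c))⟩, ?_, ?_⟩
  · have : 0 < -(2 * q * c) := by nlinarith [mul_pos hq (neg_pos.2 hc)]
    exact div_pos hs0 this
  · have ht : t = 2 * c + 1 + q := by linarith
    have hc0 := hc.ne
    have hq0 := hq.ne'
    apply Complex.ext
    · simp
      field_simp
      rw [ht] at hs ⊢
      linear_combination -hs
    · simp
      field_simp
      rw [ht]
      ring

theorem exists_isLandenCycle {n : ℕ} (hn : 2 ≤ n) {t : ℤ} (ht : 4 ∣ t - 1)
    (htn : t ^ 2 < 4 * 2 ^ n) :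
    ∃ (l : ℕ → ℂ) (w : ℂ), IsLandenCycle n l w ∧ w ^ 2 - t * w + 2 ^ n = 0 ∧ w.im ≠ 0 := by
  obtain ⟨c, hc⟩ : ∃ c : ℤ, 4 * c = t - 1 - 2 ^ n :=
    (dvd_sub ht (pow_dvd_pow (2 : ℤ) hn)).imp fun _ h => h.symm
  have hc0 : c < 0 := by nlinarith [sq_nonneg (t - 2)]
  have hcR : 4 * (c : ℝ) = t - 1 - 2 ^ n := by exact_mod_cast hc
  have hc0R : (c : ℝ) < 0 := by exact_mod_cast hc0
  obtain ⟨τ, hτ, hτq⟩ := exists_upperHalfPlane_root (q := 2 ^ n) (t := t) (c := 2 * c)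
    (by linarith) (by exact_mod_cast htn) (by linarith)
  push_cast at hτq
  have hd : 2 * c * τ + 1 ≠ 0 := by
    intro h
    rw [h, mul_zero, mul_zero, zero_add] at hτq
    simp [← hτq] at hτ
  have hqτ : 2 ^ n * τ = τ / (2 * c * τ + 1) + 2 := by
    rw [← sub_eq_iff_eq_add, eq_div_iff hd]
    linear_combination hτq
  have him (k : ℕ) : 0 < (2 ^ k * τ).im := by
    have : ((2 : ℂ) ^ k) = ((2 ^ k : ℝ) : ℂ) := by push_cast; rfl
    rw [this, Complex.im_ofReal_mul]
    positivity
  have hσ : 0 < (τ / (2 * c * τ + 1)).im := by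
    have := him n
    rwa [hqτ, Complex.add_im, Complex.im_ofNat, add_zero] at this
  have hθ (z : ℂ) (m : ℤ) (hz : 2 * c * z = m) : jacobiTheta₂ z (2 ^ n * τ) ^ 2 =
      (2 * c * τ + 1) * Complex.exp (-2 * Real.pi * Complex.I * m * z) *
        jacobiTheta₂ z τ ^ 2 := by
    rw [hqτ, jacobiTheta₂_add_right, jacobiTheta₂_sq_div hτ hz hσ]
  have hcτ : (2 * c * τ).im ≠ 0 := by
    have : (2 * c * τ : ℂ) = ((2 * c : ℝ) : ℂ) * τ := by push_cast; rfl
    rw [this, Complex.im_ofReal_mul]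
    exact mul_ne_zero (by linarith) hτ.ne'
  refine ⟨_, 2 ^ n * (2 * c * τ + 1), isLandenCycle_of_agm
    (a := fun k => jacobiTheta₂ 0 (2 ^ k * τ) ^ 2)
    (b := fun k => jacobiTheta₂ (1 / 2) (2 ^ k * τ) ^ 2) (by omega) (fun k => ?_) (fun k => ?_) ?_
    ?_ ?_ ?_, ?_, ?_⟩
  · have := jacobiTheta₂_duplication 0 (him k)
    rw [pow_succ' 2 k, mul_assoc, ← this]
    ring_nf
  · have := jacobiTheta₂_duplication (1 / 2) (him k)
    rw [show (1 / 2 + 1 / 2 : ℂ) = 0 + 1 by norm_num, jacobiTheta₂_add_left] at this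
    rw [pow_succ' 2 k, mul_assoc]
    have h : jacobiTheta₂ (1 / 2) (2 * (2 ^ k * τ)) ^ 2 =
        jacobiTheta₂ 0 (2 ^ k * τ) * jacobiTheta₂ (1 / 2) (2 ^ k * τ) := by
      linear_combination -this / 2
    rw [h, mul_pow]
  · simpa only [jacobiTheta₂_half, Complex.ofReal_one, one_pow] using (tendsto_jacobiTheta_two_pow_mul hτ 1).pow 2
  · simpa using hθ 0 0 (by simp)
  · have h : Complex.exp (-2 * Real.pi * Complex.I * c * (1 / 2)) ^ 2 = 1 := by
      rw [← Complex.exp_nat_mul, Complex.exp_eq_one_iff]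
      exact ⟨-c, by push_cast; ring⟩
    rw [hθ (1 / 2) c (by ring), mul_pow, mul_pow, h, mul_one, pow_zero, one_mul]
  · intro h
    rw [add_eq_right] at h
    exact hcτ (by rw [h, Complex.zero_im])
  · have hcC : 4 * (c : ℂ) = t - 1 - 2 ^ n := by exact_mod_cast hc
    linear_combination (2 ^ n * 2 * c : ℂ) * hτq + (2 ^ n + 2 ^ n * 2 * c * τ : ℂ) * hcC
  · have : (2 : ℂ) ^ n = ((2 ^ n : ℝ) : ℂ) := by push_cast; rfl
    rw [this, Complex.im_ofReal_mul, Complex.add_im, Complex.one_im, add_zero]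
    exact mul_ne_zero (by positivity) hcτ

end LandenCycle

section UnitCycle

open Polynomial

variable {R : Type*} [CommRing R]

/-- A periodic solution in units of the Landen recursion, in the coordinate `c = (l - 1) / 8`. -/
structure IsUnitCycle (n : ℕ) (c : ℕ → R) : Prop where
  periodic : Function.Periodic c n
  isUnit : ∀ k, IsUnit (c k)
  rel : ∀ k, c (k + 1) * (1 + 4 * c (k + 1)) * (1 + 4 * c k) ^ 2 = -c k ^ 2

/-- Numerator and denominator of the iterated 2-isogeny attached to `c`. -/
noncomputable def isogeny (c : ℕ → R) : ℕ → R[X] × R[X]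
  | 0 => (X, 1)
  | k + 1 =>
    ((isogeny c k).1 * ((isogeny c k).1 - C (4 * (c k * (1 + 4 * c k))) * (isogeny c k).2),
      C ((1 + 4 * c k) ^ 2) * (isogeny c k).2 * ((isogeny c k).2 + 4 * (isogeny c k).1))

variable (c : ℕ → R)

theorem natDegree_isogeny_le (k : ℕ) :
    (isogeny c k).1.natDegree ≤ 2 ^ k ∧ (isogeny c k).2.natDegree ≤ 2 ^ k - 1 := by
  induction k with
  | zero => simpa [isogeny] using natDegree_X_le
  | succ k ih =>
    obtain ⟨h1, h2⟩ := ih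
    have hk : 0 < 2 ^ k := by positivity
    have h4 : (4 * (isogeny c k).1).natDegree ≤ 2 ^ k :=
      (natDegree_C_mul_le 4 (isogeny c k).1).trans h1
    constructor
    · refine natDegree_mul_le.trans ?_
      have := (natDegree_sub_le_of_le h1 ((natDegree_C_mul_le (4 * (c k * (1 + 4 * c k))) _).trans h2))
      rw [pow_succ]
      omega
    · refine natDegree_mul_le.trans ?_
      have := (natDegree_C_mul_le ((1 + 4 * c k) ^ 2) (isogeny c k).2).trans h2
      have := (natDegree_add_le_of_le h2 h4).trans_eq (max_eq_right (Nat.sub_le _ _))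
      have hp : 2 ^ (k + 1) = 2 ^ k * 2 := pow_succ 2 k
      omega

theorem coeff_isogeny_fst (k : ℕ) : (isogeny c k).1.coeff (2 ^ k) = 1 := by
  induction k with
  | zero => simp [isogeny]
  | succ k ih =>
    obtain ⟨h1, h2⟩ := natDegree_isogeny_le c k
    have hk : 0 < 2 ^ k := by positivity
    have h3 := (natDegree_C_mul_le (4 * (c k * (1 + 4 * c k))) _).trans h2
    rw [pow_succ, mul_two, isogeny, coeff_mul_add_eq_of_natDegree_le h1
      ((natDegree_sub_le_of_le h1 h3).trans (by omega)), coeff_sub,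
      coeff_eq_zero_of_natDegree_lt (h3.trans_lt (by omega)), ih, sub_zero, mul_one]

theorem coeff_isogeny_snd (k : ℕ) :
    (isogeny c k).2.coeff (2 ^ k - 1) = (∏ i ∈ range k, (2 * (1 + 4 * c i))) ^ 2 := by
  induction k with
  | zero => simp [isogeny]
  | succ k ih =>
    obtain ⟨h1, h2⟩ := natDegree_isogeny_le c k
    have hk : 0 < 2 ^ k := by positivity
    have h4 : (4 * (isogeny c k).1).natDegree ≤ 2 ^ k :=
      (natDegree_C_mul_le 4 (isogeny c k).1).trans h1
    have h5 : (4 * (isogeny c k).1).coeff (2 ^ k) = 4 := by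
      rw [show (4 : R[X]) = C 4 from rfl, coeff_C_mul, coeff_isogeny_fst, mul_one]
    rw [show 2 ^ (k + 1) - 1 = 2 ^ k - 1 + 2 ^ k by rw [pow_succ]; omega, isogeny,
      coeff_mul_add_eq_of_natDegree_le ((natDegree_C_mul_le _ _).trans h2)
      ((natDegree_add_le_of_le h2 h4).trans (by omega)), coeff_add, h5,
      coeff_eq_zero_of_natDegree_lt (h2.trans_lt (by omega)), coeff_C_mul, ih, prod_range_succ]
    ring

theorem natDegree_isogeny_sub_le (k : ℕ) :
    ((isogeny c k).1 - X * (isogeny c k).2).natDegree ≤ 2 ^ k := by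
  obtain ⟨h1, h2⟩ := natDegree_isogeny_le c k
  have hk : 0 < 2 ^ k := by positivity
  refine (natDegree_sub_le_of_le h1 (natDegree_mul_le_of_le natDegree_X_le h2)).trans ?_
  omega

theorem coeff_isogeny_sub (k : ℕ) : ((isogeny c k).1 - X * (isogeny c k).2).coeff (2 ^ k) =
    1 - (∏ i ∈ range k, (2 * (1 + 4 * c i))) ^ 2 := by
  have hk : 2 ^ k = 2 ^ k - 1 + 1 := (Nat.sub_add_cancel Nat.one_le_two_pow).symm
  rw [coeff_sub, coeff_isogeny_fst, hk, coeff_X_mul, coeff_isogeny_snd]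

theorem eval_zero_isogeny_fst (k : ℕ) : (isogeny c k).1.eval 0 = 0 := by
  induction k with
  | zero => simp [isogeny]
  | succ k ih => simp [isogeny, ih]

theorem map_isogeny {S : Type*} [CommRing S] [CharP S 2] (f : R →+* S) (k : ℕ) :
    (isogeny c k).1.map f = X ^ 2 ^ k ∧ (isogeny c k).2.map f = 1 := by
  have h4 : f 4 = 0 := by
    rw [map_ofNat]
    linear_combination 2 * CharTwo.two_eq_zero (R := S)
  induction k with
  | zero => simp [isogeny]
  | succ k ih =>
    have h4' : (4 : S[X]) = 0 := by
      rw [show (4 : S[X]) = C 4 from rfl, ← map_ofNat f 4, h4, C_0]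
    constructor
    · simp [isogeny, ih, h4, pow_add, pow_succ, mul_two]
    · simp [isogeny, ih, h4', h4]

theorem wronskian_isogeny_succ (k : ℕ) :
    derivative (isogeny c (k + 1)).1 * (isogeny c (k + 1)).2
        - (isogeny c (k + 1)).1 * derivative (isogeny c (k + 1)).2 =
      C (2 * (1 + 4 * c k) ^ 2) * (2 * (isogeny c k).1 ^ 2 + (isogeny c k).1 * (isogeny c k).2
          - C (2 * (c k * (1 + 4 * c k))) * (isogeny c k).2 ^ 2) *
        (derivative (isogeny c k).1 * (isogeny c k).2
          - (isogeny c k).1 * derivative (isogeny c k).2) := by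
  rw [isogeny]
  generalize (isogeny c k).1 = P
  generalize (isogeny c k).2 = Q
  generalize c k = a
  have h4 : derivative (4 : R[X]) = 0 := derivative_ofNat 4
  simp only [derivative_mul, derivative_sub, derivative_add, derivative_C, h4]
  simp only [C_mul, C_pow, map_ofNat]
  ring

variable {c} [IsLocalRing R] (h2 : (2 : R) ∈ IsLocalRing.maximalIdeal R)

include h2

theorem isUnit_add_four_mul {x : R} (hx : IsUnit x) (y : R) : IsUnit (x + 4 * y) := by
  by_contra h
  have h' : x + 4 * y - 2 * (2 * y) ∈ IsLocalRing.maximalIdeal R :=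
    sub_mem h (Ideal.mul_mem_right _ _ h2)
  rw [show x + 4 * y - 2 * (2 * y) = x by ring] at h'
  exact h' hx

theorem isUnit_eval_isogeny_snd (c : ℕ → R) (x : R) (k : ℕ) :
    IsUnit ((isogeny c k).2.eval x) := by
  induction k with
  | zero => simp [isogeny]
  | succ k ih =>
    simp only [isogeny, eval_mul, eval_C, eval_add, eval_ofNat]
    exact (((isUnit_add_four_mul h2 isUnit_one _).pow 2).mul ih).mul (isUnit_add_four_mul h2 ih _)

end UnitCycle

section Multiplier

open Polynomial

/-- The data of a point `x` fixed by the iterated isogeny: its orbit `X` and the multipliers `m`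
of the invariant differential along the orbit. -/
structure IsMultiplier {R : Type*} [CommRing R] (n : ℕ) (c X m : ℕ → R) : Prop where
  closed : X n = X 0
  orbit : ∀ k, X (k + 1) * ((1 + 4 * c k) ^ 2 * (1 + 4 * X k)) =
    X k * (X k - 4 * (c k * (1 + 4 * c k)))
  mult : ∀ k, m k * ((1 + 4 * c k) ^ 3 * (1 + 4 * X k) ^ 2) =
    2 * X k ^ 2 + X k - 2 * (c k * (1 + 4 * c k))

variable {R : Type*} [CommRing R] [IsLocalRing R] {n : ℕ} {c : ℕ → R}

theorem exists_isMultiplier (h2 : (2 : R) ∈ IsLocalRing.maximalIdeal R) {x : R}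
    (hx : ((isogeny c n).1 - Polynomial.X * (isogeny c n).2).eval x = 0) :
    ∃ X m : ℕ → R, X 0 = x ∧ IsMultiplier n c X m ∧
      (derivative ((isogeny c n).1 - Polynomial.X * (isogeny c n).2)).eval x =
        (isogeny c n).2.eval x * (∏ k ∈ range n, (2 * (1 + 4 * c k) * m k) - 1) := by
  have hQ := isUnit_eval_isogeny_snd h2 c x
  have hX (k) : ∃ y, (isogeny c k).1.eval x = y * (isogeny c k).2.eval x :=
    (hQ k).dvd.imp fun _ h => h.trans (mul_comm _ _)
  choose X hX using hX
  have hh (k) : IsUnit ((1 + 4 * c k) ^ 3 * (1 + 4 * X k) ^ 2) :=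
    ((isUnit_add_four_mul h2 isUnit_one _).pow 3).mul
      ((isUnit_add_four_mul h2 isUnit_one _).pow 2)
  have hm (k) : ∃ m, m * ((1 + 4 * c k) ^ 3 * (1 + 4 * X k) ^ 2) =
      2 * X k ^ 2 + X k - 2 * (c k * (1 + 4 * c k)) :=
    (hh k).dvd.imp fun _ h => (mul_comm _ _).trans h.symm
  choose m hm using hm
  have hX0 : X 0 = x := by simpa [isogeny] using (hX 0).symm
  have hXn : X n = x := by
    refine (hQ n).mul_right_cancel ?_
    rw [← hX n]
    simpa [sub_eq_zero] using hx
  refine ⟨X, m, hX0, ⟨hXn.trans hX0.symm, fun k => ?_, hm⟩, ?_⟩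
  · refine ((hQ k).pow 2).mul_right_cancel ?_
    have h := hX (k + 1)
    simp only [isogeny, eval_mul, eval_C, eval_add, eval_sub, eval_ofNat, hX k] at h
    linear_combination -h
  · have hW (k) : (derivative (isogeny c k).1 * (isogeny c k).2
        - (isogeny c k).1 * derivative (isogeny c k).2).eval x =
        (∏ i ∈ range k, (2 * (1 + 4 * c i) * m i)) * (isogeny c k).2.eval x ^ 2 := by
      induction k with
      | zero => simp [isogeny]
      | succ k ih =>
        rw [wronskian_isogeny_succ, eval_mul, ih, prod_range_succ, isogeny]
        simp only [eval_mul, eval_C, eval_add, eval_sub, eval_ofNat, eval_pow, hX k]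
        linear_combination (-2 * (1 + 4 * c k) ^ 2 *
          (∏ i ∈ range k, (2 * (1 + 4 * c i) * m i)) * (isogeny c k).2.eval x ^ 4) * hm k
    refine (hQ n).mul_right_cancel ?_
    have h := hW n
    simp only [eval_sub, eval_mul] at h
    rw [hX n, hXn] at h
    simp only [derivative_sub, derivative_mul, derivative_X, eval_sub, eval_mul, eval_add,
      eval_X, eval_one]
    linear_combination h

omit [IsLocalRing R]

theorem prod_range_shift {f : ℕ → R} (hf : f n = f 0) :
    ∏ k ∈ range n, f (k + 1) = ∏ k ∈ range n, f k := by
  obtain _ | n := n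
  · simp
  rw [prod_range_succ, prod_range_succ', hf]

theorem IsUnitCycle.prod_cube (hc : IsUnitCycle n c) :
    ∏ k ∈ range n, (1 + 4 * c k) ^ 3 = ∏ k ∈ range n, (-c k) := by
  have hn : c n = c 0 := by simpa using hc.periodic 0
  have hu : IsUnit (∏ k ∈ range n, c k) := by simpa using fun k _ => hc.isUnit k
  refine hu.mul_left_cancel ?_
  have h := prod_congr rfl fun k (_ : k ∈ range n) => hc.rel k
  rw [prod_mul_distrib, prod_range_shift (f := fun k => c k * (1 + 4 * c k)) (by simp [hn]),
    ← prod_mul_distrib] at h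
  rw [← prod_mul_distrib, ← prod_mul_distrib]
  exact (prod_congr rfl fun k _ => by ring).trans (h.trans (prod_congr rfl fun k _ => by ring))

theorem prod_one_add_two_mul {S : Type*} [CommRing S] (h4 : (4 : S) = 0) (T : ℕ → S) (n : ℕ) :
    ∏ k ∈ range n, (1 + 2 * T k) = 1 + 2 * ∑ k ∈ range n, T k := by
  induction n with
  | zero => simp
  | succ n ih =>
    rw [prod_range_succ, sum_range_succ, ih]
    linear_combination ((∑ k ∈ range n, T k) * T n) * h4

namespace IsMultiplier

variable {X m : ℕ → R}

theorem prod_eq_of_zero (hh : ∀ k, IsUnit (1 + 4 * c k)) (hc : IsUnitCycle n c)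
    (h : IsMultiplier n c X m) (h0 : ∀ k, X k = 0) :
    ∏ k ∈ range n, (2 * (1 + 4 * c k) * m k) = (∏ k ∈ range n, (2 * (1 + 4 * c k))) ^ 2 := by
  have hu : IsUnit (∏ k ∈ range n, (1 + 4 * c k) ^ 2) := by simpa using fun k _ => (hh k).pow 2
  refine hu.mul_right_cancel ?_
  have h3 : (∏ k ∈ range n, 4 * (1 + 4 * c k)) * ∏ k ∈ range n, (1 + 4 * c k) ^ 3 =
      (∏ k ∈ range n, 2 * (1 + 4 * c k) * m k) * ∏ k ∈ range n, (1 + 4 * c k) ^ 2 := by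
    rw [hc.prod_cube, ← prod_mul_distrib, ← prod_mul_distrib]
    refine prod_congr rfl fun k _ => ?_
    have := h.mult k
    rw [h0] at this
    linear_combination -2 * this
  rw [← h3, ← prod_pow, ← prod_mul_distrib, ← prod_mul_distrib]
  exact prod_congr rfl fun k _ => by ring

theorem prod_sq [IsLocalRing R] (h2 : (2 : R) ∈ IsLocalRing.maximalIdeal R)
    (hc : IsUnitCycle n c) (h : IsMultiplier n c X m) (h0 : IsUnit (X 0)) :
    (∏ k ∈ range n, m k) ^ 2 = 1 := by
  set E : ℕ → R := fun k => X k * (1 + 4 * X k) * (X k - 4 * (c k * (1 + 4 * c k))) with hE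
  have hE0 : IsUnit (E 0) := by
    refine (h0.mul (isUnit_add_four_mul h2 isUnit_one _)).mul ?_
    simpa [sub_eq_add_neg] using isUnit_add_four_mul h2 h0 (-(c 0 * (1 + 4 * c 0)))
  have hstep (k) : E (k + 1) = m k ^ 2 * E k := by
    have hA : IsUnit ((1 + 4 * c k) ^ 2 * (1 + 4 * X k)) :=
      ((isUnit_add_four_mul h2 isUnit_one _).pow 2).mul (isUnit_add_four_mul h2 isUnit_one _)
    refine (hA.pow 3).mul_right_cancel ?_
    have h1 : ((1 + 4 * c k) ^ 2 * (1 + 4 * X k)) * (1 + 4 * X (k + 1)) =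
        (1 + 4 * c k + 2 * X k) ^ 2 := by linear_combination 4 * h.orbit k
    have h3 : ((1 + 4 * c k) ^ 2 * (1 + 4 * X k)) *
        (X (k + 1) - 4 * (c (k + 1) * (1 + 4 * c (k + 1)))) = (X k - 2 * c k) ^ 2 := by
      linear_combination h.orbit k - 4 * (1 + 4 * X k) * hc.rel k
    calc E (k + 1) * ((1 + 4 * c k) ^ 2 * (1 + 4 * X k)) ^ 3
        = (X (k + 1) * ((1 + 4 * c k) ^ 2 * (1 + 4 * X k))) *
          (((1 + 4 * c k) ^ 2 * (1 + 4 * X k)) * (1 + 4 * X (k + 1))) *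
          (((1 + 4 * c k) ^ 2 * (1 + 4 * X k)) *
            (X (k + 1) - 4 * (c (k + 1) * (1 + 4 * c (k + 1))))) := by rw [hE]; ring
      _ = (X k * (X k - 4 * (c k * (1 + 4 * c k)))) *
          (2 * X k ^ 2 + X k - 2 * (c k * (1 + 4 * c k))) ^ 2 := by
        rw [h.orbit, h1, h3]; ring
      _ = m k ^ 2 * E k * ((1 + 4 * c k) ^ 2 * (1 + 4 * X k)) ^ 3 := by
        rw [← h.mult, hE]; ring
  have hprod (j) : (∏ k ∈ range j, m k) ^ 2 * E 0 = E j := by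
    induction j with
    | zero => simp
    | succ j ih => rw [prod_range_succ, hstep, ← ih]; ring
  have hn : c n = c 0 := by simpa using hc.periodic 0
  have hEn : E n = E 0 := by simp only [hE, hn, h.closed]
  exact hE0.mul_right_cancel (by rw [hprod, hEn, one_mul])

theorem four_dvd_prod_sub (h : IsMultiplier n c X m) {u : ℕ → R} (hu : ∀ k, X k * u k = 1) :
    4 ∣ ∏ k ∈ range n, m k - (1 + 2 * ∑ k ∈ range n, (X k - c k * u k)) := by
  rw [← Ideal.mem_span_singleton, ← Ideal.Quotient.eq]
  set f := Ideal.Quotient.mk (Ideal.span {(4 : R)})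
  have h4 : (4 : R ⧸ Ideal.span {(4 : R)}) = 0 :=
    (map_ofNat f 4).symm.trans (Ideal.Quotient.eq_zero_iff_mem.2 (Ideal.mem_span_singleton_self 4))
  have hX (k) : f (X (k + 1)) = f (X k) ^ 2 := by
    have := congrArg f (h.orbit k)
    simp only [map_mul, map_add, map_sub, map_pow, map_one, map_ofNat, h4] at this
    linear_combination this
  have hm (k) : f (m k) = f (X k) * (1 + 2 * (f (X k) - f (c k) * f (u k))) := by
    have h1 := congrArg f (h.mult k)
    have h2 := congrArg f (hu k)
    simp only [map_mul, map_add, map_sub, map_pow, map_one, map_ofNat, h4] at h1 h2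
    linear_combination h1 + 2 * f (c k) * h2
  have hone : ∏ k ∈ range n, f (X k) = 1 := by
    have hunit : IsUnit (∏ k ∈ range n, f (X k)) := by
      simpa using fun k _ => (IsUnit.of_mul_eq_one _ (hu k)).map f
    refine hunit.mul_left_cancel ?_
    rw [mul_one, ← sq, ← prod_pow, ← prod_range_shift (f := fun k => f (X k)) (by simp [h.closed])]
    exact prod_congr rfl fun k _ => (hX k).symm
  rw [map_prod, prod_congr rfl fun k _ => hm k, prod_mul_distrib, hone, one_mul,
    prod_one_add_two_mul h4]
  simp [map_ofNat]

end IsMultiplier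

end Multiplier

section PartialFractions

open Polynomial

theorem sum_eval_div_derivative {K ι : Type*} [Field K] [Fintype ι] {r : ι → K}
    (hr : Function.Injective r) {G Q : K[X]} (hG : G.natDegree ≤ Fintype.card ι)
    (hroot : ∀ i, G.eval (r i) = 0)
    (hQ : Q.degree < Fintype.card ι) :
    ∑ i, Q.eval (r i) / (derivative G).eval (r i) =
      Q.coeff (Fintype.card ι - 1) / G.coeff (Fintype.card ι) := by
  classical
  have hGn : G = C (G.coeff (Fintype.card ι)) * Lagrange.nodal univ r := by
    refine eq_of_degree_sub_lt_of_eval_index_eq univ hr.injOn ?_ fun i hi => ?_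
    · rw [card_univ, degree_lt_iff_coeff_zero]
      intro j hj
      rw [coeff_sub, coeff_C_mul]
      obtain rfl | hj := hj.eq_or_lt
      · have : (Lagrange.nodal univ r).coeff (Fintype.card ι) = 1 := by
          simpa [Lagrange.natDegree_nodal, card_univ] using
            (Lagrange.nodal_monic (s := univ) (v := r)).coeff_natDegree
        rw [this, mul_one, sub_self]
      · rw [coeff_eq_zero_of_natDegree_lt (hG.trans_lt hj),
          coeff_eq_zero_of_natDegree_lt (p := Lagrange.nodal univ r)
            (by rwa [Lagrange.natDegree_nodal, card_univ]), mul_zero, sub_zero]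
    · rw [hroot, eval_mul, Lagrange.eval_nodal_at_node hi, mul_zero]
  have hd (i) : (derivative G).eval (r i) =
      G.coeff (Fintype.card ι) * ∏ j ∈ univ.erase i, (r i - r j) := by
    conv_lhs => rw [hGn]
    rw [derivative_C_mul, eval_mul, eval_C, Lagrange.eval_nodal_derivative_eval_node_eq (mem_univ i),
      Lagrange.eval_nodal]
  have h := Lagrange.coeff_eq_sum (s := univ) (v := r) hr.injOn (P := Q) (by rwa [card_univ])
  rw [card_univ] at h
  rw [h, sum_div]
  refine sum_congr rfl fun i _ => ?_
  rw [hd, div_div, mul_comm]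

end PartialFractions

section Residue

open Polynomial IsLocalRing

variable {K : Type*} [Field K] [IsAlgClosed K] (𝒪 : ValuationSubring K)

theorem exists_root_sub_mem_maximalIdeal {f : 𝒪[X]} {N : ℕ} (hN : f.natDegree ≤ N)
    (hf : IsUnit (f.coeff N)) {y : 𝒪} (hy : f.eval y ∈ maximalIdeal 𝒪) :
    ∃ x : 𝒪, f.eval x = 0 ∧ x - y ∈ maximalIdeal 𝒪 := by
  have hinj : Function.Injective (algebraMap 𝒪 K) := Subtype.val_injective
  have hNf : f.natDegree = N := le_antisymm hN (le_natDegree_of_ne_zero hf.ne_zero)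
  subst hNf
  have h := (IsAlgClosed.splits (f.map (algebraMap 𝒪 K))).eval_eq_prod_roots (algebraMap 𝒪 K y)
  rw [eval_map_apply, leadingCoeff_map_of_injective hinj] at h
  have hv := congrArg 𝒪.valuation h
  rw [map_mul, show 𝒪.valuation (algebraMap 𝒪 K f.leadingCoeff) = 1 from
    (𝒪.valuation_eq_one_iff _).1 hf, one_mul, map_multiset_prod, Multiset.map_map] at hv
  obtain ⟨r, hr, hr1⟩ : ∃ r ∈ (f.map (algebraMap 𝒪 K)).roots,
      𝒪.valuation (algebraMap 𝒪 K y - r) < 1 := by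
    by_contra! hcon
    exact ((𝒪.valuation_lt_one_iff _).1 hy).not_ge (hv ▸ Multiset.one_le_prod_map hcon)
  have hrO : r ∈ 𝒪 := by
    have := 𝒪.sub_mem y.2 (𝒪.mem_of_valuation_le_one _ hr1.le)
    simpa using this
  refine ⟨⟨r, hrO⟩, ?_, ?_⟩
  · have := isRoot_of_mem_roots hr
    rw [show r = algebraMap 𝒪 K ⟨r, hrO⟩ from rfl, IsRoot, eval_map_apply] at this
    exact hinj (this.trans (map_zero _).symm)
  · rw [← neg_sub, neg_mem_iff]
    exact (𝒪.valuation_lt_one_iff _).2 hr1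

theorem isAlgClosed_residueField : IsAlgClosed (ResidueField 𝒪) := by
  refine IsAlgClosed.of_exists_root _ fun p hp hirr => ?_
  obtain ⟨f, hf, hdeg, hmon⟩ := lifts_and_natDegree_eq_and_monic
    ((mem_lifts p).2 (map_surjective (residue 𝒪) residue_surjective p)) hp
  have hinj : Function.Injective (algebraMap 𝒪 K) := Subtype.val_injective
  obtain ⟨r, hr⟩ := IsAlgClosed.exists_root (f.map (algebraMap 𝒪 K)) (by
    rw [degree_map_eq_of_injective hinj, degree_eq_natDegree hmon.ne_zero, hdeg]
    exact_mod_cast hirr.natDegree_pos.ne')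
  obtain ⟨x, rfl⟩ := IsIntegrallyClosed.algebraMap_eq_of_integral (R := 𝒪)
    ⟨f, hmon, by rwa [IsRoot, eval_map] at hr⟩
  rw [IsRoot, eval_map_apply] at hr
  refine ⟨residue 𝒪 x, ?_⟩
  rw [← hf, eval_map_apply, hinj (hr.trans (map_zero _).symm), map_zero]

end Residue

section Sign

open IsLocalRing

theorem eq_pow_two_pow {S : Type*} [Monoid S] {x : ℕ → S} (h : ∀ k, x (k + 1) = x k ^ 2) (k : ℕ) :
    x k = x 0 ^ 2 ^ k := by
  induction k with
  | zero => simp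
  | succ k ih => rw [h, ih, ← pow_mul, pow_succ]

variable {n : ℕ} {F : Type*} [Field F] [Fintype F] [Algebra (ZMod 2) F]

theorem map_trace_eq_sum {k : Type*} [Field k] [Algebra (ZMod 2) k] (ι : F →+* k)
    (hF : Fintype.card F = 2 ^ n) (x : F) :
    algebraMap (ZMod 2) k (Algebra.trace (ZMod 2) F x) = ∑ i ∈ range n, ι x ^ 2 ^ i := by
  have hn : Module.finrank (ZMod 2) F = n := by
    have := Module.card_eq_pow_finrank (K := ZMod 2) (V := F)
    rw [hF, ZMod.card] at this
    exact (Nat.pow_right_injective le_rfl this).symm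
  have := congrArg ι (FiniteField.algebraMap_trace_eq_sum_pow (ZMod 2) F x)
  rw [hn, Nat.card_zmod] at this
  rw [← RingHom.congr_fun (Subsingleton.elim (ι.comp (algebraMap (ZMod 2) F)) _)
    (Algebra.trace (ZMod 2) F x), RingHom.comp_apply, this]
  simp

variable {R : Type*} [CommRing R] [IsLocalRing R] {c X m : ℕ → R}

theorem residue_two (h2 : (2 : R) ∈ maximalIdeal R) : (2 : ResidueField R) = 0 :=
  (map_ofNat (residue R) 2).symm.trans ((residue_eq_zero_iff 2).2 h2)

theorem IsUnitCycle.residue_succ (h2 : (2 : R) ∈ maximalIdeal R) (hc : IsUnitCycle n c) (k : ℕ) :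
    residue R (c (k + 1)) = residue R (c k) ^ 2 := by
  have := congrArg (residue R) (hc.rel k)
  have h := residue_two h2
  have h4 : (4 : ResidueField R) = 0 := by linear_combination 2 * h
  simp only [map_mul, map_add, map_neg, map_pow, map_one, map_ofNat, h4] at this
  linear_combination this - residue R (c k) ^ 2 * h

theorem IsMultiplier.residue_succ (h2 : (2 : R) ∈ maximalIdeal R) (h : IsMultiplier n c X m)
    (k : ℕ) : residue R (X (k + 1)) = residue R (X k) ^ 2 := by
  have := congrArg (residue R) (h.orbit k)
  have h4 : (4 : ResidueField R) = 0 := by linear_combination 2 * residue_two h2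
  simp only [map_mul, map_add, map_sub, map_pow, map_one, map_ofNat, h4] at this
  linear_combination this

/-- The product of the multipliers along a closed orbit is the sign `signChar F (x + a / x)`. -/
theorem IsMultiplier.prod_eq_signChar [IsDomain R] (h2 : (2 : R) ∈ maximalIdeal R) (h20 : (2 : R) ≠ 0)
    (hF : Fintype.card F = 2 ^ n) (ι : F →+* ResidueField R) (hc : IsUnitCycle n c)
    (h : IsMultiplier n c X m) {a x : F} (ha : residue R (c 0) = ι a)
    (hx : residue R (X 0) = ι x) (hx0 : x ≠ 0) :
    ∏ k ∈ range n, m k = signChar F (x + a * x⁻¹) := by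
  have h2k := residue_two h2
  have : CharP (ResidueField R) 2 := CharTwo.of_one_ne_zero_of_two_eq_zero one_ne_zero h2k
  let _ : Algebra (ZMod 2) (ResidueField R) := ZMod.algebra _ 2
  have hXk (k) : residue R (X k) = ι x ^ 2 ^ k := by
    rw [eq_pow_two_pow (x := fun k => residue R (X k)) (h.residue_succ h2) k, hx]
  have hck (k) : residue R (c k) = ι a ^ 2 ^ k := by
    rw [eq_pow_two_pow (x := fun k => residue R (c k)) (hc.residue_succ h2) k, ha]
  have hιx : ι x ≠ 0 := by simpa using hx0
  have hXu (k) : IsUnit (X k) := by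
    rw [← residue_ne_zero_iff_isUnit, hXk]
    exact pow_ne_zero _ hιx
  choose u hu using fun k => (hXu k).exists_right_inv
  have huk (k) : residue R (u k) = ι x⁻¹ ^ 2 ^ k := by
    have := congrArg (residue R) (hu k)
    rw [map_mul, hXk, map_one] at this
    rw [map_inv₀, inv_pow]
    exact eq_inv_of_mul_eq_one_right this
  have hT : residue R (∑ k ∈ range n, (X k - c k * u k)) =
      algebraMap (ZMod 2) _ (Algebra.trace (ZMod 2) F (x + a * x⁻¹)) := by
    rw [map_trace_eq_sum ι hF, map_sum]
    refine sum_congr rfl fun k _ => ?_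
    rw [map_sub, map_mul, hXk, hck, huk, map_add, map_mul, add_pow_expChar_pow _ _ 2,
      CharTwo.sub_eq_add, mul_pow]
  obtain ⟨z, hz⟩ := h.four_dvd_prod_sub hu
  have hsq := h.prod_sq h2 hc (hXu 0)
  generalize ∑ k ∈ range n, (X k - c k * u k) = T at hT hz
  rw [signChar_apply]
  split_ifs with htr
  · rw [htr, map_zero] at hT
    rw [Int.cast_one]
    refine (mul_self_eq_one_iff.1 ((sq _).symm.trans hsq)).resolve_right fun hs => ?_
    have : 1 + T + 2 * z = 0 := by
      refine (mul_eq_zero.1 ?_).resolve_left h20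
      linear_combination -hz + hs
    simpa [map_ofNat, h2k, hT] using congrArg (residue R) this
  · have htr1 : Algebra.trace (ZMod 2) F (x + a * x⁻¹) = 1 := by
      revert htr
      generalize Algebra.trace (ZMod 2) F (x + a * x⁻¹) = v
      revert v
      decide
    rw [htr1, map_one] at hT
    refine ((mul_self_eq_one_iff.1 ((sq _).symm.trans hsq)).resolve_left fun hs => ?_).trans
      (by simp)
    have : T + 2 * z = 0 := by
      refine (mul_eq_zero.1 ?_).resolve_left h20
      linear_combination -hz + hs
    simpa [map_ofNat, h2k, hT] using congrArg (residue R) this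

end Sign

section FrobeniusTrace

open Polynomial IsLocalRing

theorem exists_map_eq_of_pow_card_eq {F k : Type*} [Field F] [Fintype F] [Field k] (ι : F →+* k)
    {y : k} (hy : y ^ Fintype.card F = y) : ∃ a, ι a = y := by
  classical
  by_contra! hcon
  have h0 := eq_zero_of_natDegree_lt_card_of_eval_eq_zero' (X ^ Fintype.card F - X : k[X])
    (insert y (univ.image ι)) (fun z hz => by
      obtain rfl | hz := mem_insert.1 hz
      · simp [hy]
      · obtain ⟨a, -, rfl⟩ := mem_image.1 hz
        simp [← map_pow, FiniteField.pow_card]) (by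
      rw [FiniteField.X_pow_card_sub_X_natDegree_eq _ Fintype.one_lt_card,
        card_insert_of_notMem (by simpa using hcon), card_image_of_injective _ ι.injective,
        card_univ]
      exact Nat.lt_succ_self _)
  exact FiniteField.X_pow_card_sub_X_ne_zero k (Fintype.one_lt_card (α := F)) h0

variable {K : Type*} [Field K] [IsAlgClosed K] {𝒪 : ValuationSubring K} {n : ℕ} {c : ℕ → 𝒪}
  {F : Type*} [Field F] [Fintype F] [Algebra (ZMod 2) F]

theorem exists_residue_embedding (h2 : (2 : 𝒪) ∈ maximalIdeal 𝒪) :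
    Nonempty (F →+* ResidueField 𝒪) := by
  have : CharP (ResidueField 𝒪) 2 :=
    CharTwo.of_one_ne_zero_of_two_eq_zero one_ne_zero (residue_two h2)
  let _ : Algebra (ZMod 2) (ResidueField 𝒪) := ZMod.algebra _ 2
  have := isAlgClosed_residueField 𝒪
  exact ⟨(IsAlgClosed.lift (R := ZMod 2) (S := F)).toRingHom⟩

omit [Algebra (ZMod 2) F] in
/-- The fixed points of the iterated isogeny lift the elements of `F`. -/
theorem exists_fixed_point (h2 : (2 : 𝒪) ∈ maximalIdeal 𝒪) (hF : Fintype.card F = 2 ^ n)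
    (ι : F →+* ResidueField 𝒪) (x : F)
    (hu : IsUnit (((isogeny c n).1 - X * (isogeny c n).2).coeff (2 ^ n))) :
    ∃ y : 𝒪, ((isogeny c n).1 - X * (isogeny c n).2).eval y = 0 ∧ residue 𝒪 y = ι x ∧
      (x = 0 → y = 0) := by
  by_cases hx : x = 0
  · exact ⟨0, by simp [eval_zero_isogeny_fst], by simp [hx], fun _ => rfl⟩
  have : CharP (ResidueField 𝒪) 2 :=
    CharTwo.of_one_ne_zero_of_two_eq_zero one_ne_zero (residue_two h2)
  obtain ⟨y₀, hy₀⟩ := residue_surjective (ι x)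
  obtain ⟨y, hy, hyy⟩ := exists_root_sub_mem_maximalIdeal 𝒪
    (f := (isogeny c n).1 - X * (isogeny c n).2) (natDegree_isogeny_sub_le c n) hu (y := y₀) (by
      rw [← residue_eq_zero_iff, ← eval_map_apply, Polynomial.map_sub, Polynomial.map_mul,
        (map_isogeny c _ n).1, (map_isogeny c _ n).2]
      simp [hy₀, ← hF, ← map_pow, FiniteField.pow_card])
  refine ⟨y, hy, ?_, fun h => absurd h hx⟩
  rwa [← hy₀, ← sub_eq_zero, ← map_sub, residue_eq_zero_iff]

/-- The multiplier `w` of a unit cycle is a root of the characteristic polynomial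
`T ^ 2 + (klSum a - 1) T + 2 ^ n` for some nonzero `a`. -/
theorem IsUnitCycle.exists_klSum (h2 : (2 : 𝒪) ∈ maximalIdeal 𝒪) (h20 : (2 : 𝒪) ≠ 0)
    (hF : Fintype.card F = 2 ^ n) (hc : IsUnitCycle n c) {w : 𝒪}
    (hw : ∏ k ∈ range n, (2 * (1 + 4 * c k)) = w) :
    ∃ a : F, a ≠ 0 ∧ w ^ 2 + (klSum a - 1) * w + 2 ^ n = 0 := by
  classical
  obtain ⟨ι⟩ := exists_residue_embedding (F := F) h2
  have hinj : Function.Injective (algebraMap 𝒪 K) := Subtype.val_injective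
  have hwm : w ∈ maximalIdeal 𝒪 := by
    obtain _ | n := n
    · exact absurd hF Fintype.one_lt_card.ne'
    rw [← hw, prod_range_succ]
    exact Ideal.mul_mem_left _ _ (Ideal.mul_mem_right _ _ h2)
  have hunit {z : 𝒪} (hz : z ∈ maximalIdeal 𝒪) : IsUnit (z - 1) := by
    rw [← residue_ne_zero_iff_isUnit, map_sub, (residue_eq_zero_iff z).2 hz]
    simp
  have hw2 : IsUnit (1 - w ^ 2) := by
    simpa using (hunit (Ideal.pow_mem_of_mem _ hwm 2 two_pos)).neg
  set G := (isogeny c n).1 - X * (isogeny c n).2 with hG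
  have hGc : G.coeff (2 ^ n) = 1 - w ^ 2 := by rw [hG, coeff_isogeny_sub, hw]
  choose r hr hrι hr0 using fun x => exists_fixed_point h2 hF ι x (c := c) (by rwa [← hG, hGc])
  obtain ⟨a, ha⟩ : ∃ a, ι a = residue 𝒪 (c 0) := by
    refine exists_map_eq_of_pow_card_eq ι ?_
    rw [hF, ← eq_pow_two_pow (x := fun k => residue 𝒪 (c k)) (hc.residue_succ h2) n,
      show c n = c 0 by simpa using hc.periodic 0]
  have hterm (x : F) : (((isogeny c n).2.map (algebraMap 𝒪 K)).eval (algebraMap 𝒪 K (r x)) /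
      (derivative (G.map (algebraMap 𝒪 K))).eval (algebraMap 𝒪 K (r x))) *
        algebraMap 𝒪 K (w ^ 2 - 1) =
      algebraMap 𝒪 K (signChar F (x + a * x⁻¹) * w + 1 - if x = 0 then w else 0) := by
    obtain ⟨Y, m, hY0, hm, hd⟩ := exists_isMultiplier h2 (hr x)
    set p := ∏ k ∈ range n, (2 * (1 + 4 * c k) * m k) with hp
    obtain ⟨hpm, hpw⟩ : p ∈ maximalIdeal 𝒪 ∧ (p - 1) *
        (signChar F (x + a * x⁻¹) * w + 1 - if x = 0 then w else 0) = w ^ 2 - 1 := by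
      by_cases hx : x = 0
      · have hY (k) : Y k = 0 := by
          induction k with
          | zero => rw [hY0, hr0 x hx]
          | succ k ih =>
            have h := hm.orbit k
            rw [ih, zero_mul] at h
            exact (mul_eq_zero.1 h).resolve_right (by
              simpa using (isUnit_add_four_mul h2 isUnit_one (c k)).ne_zero)
        have hp2 : p = w ^ 2 := by
          rw [hp, ← hw]
          exact hm.prod_eq_of_zero (fun k => isUnit_add_four_mul h2 isUnit_one _) hc hY
        refine ⟨hp2 ▸ Ideal.pow_mem_of_mem _ hwm 2 two_pos, ?_⟩
        simp [hp2, hx]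
      · have hs := hm.prod_eq_signChar h2 h20 hF ι hc ha.symm (by rw [hY0, hrι]) hx
        have hp2 : p = w * signChar F (x + a * x⁻¹) := by
          rw [hp, prod_mul_distrib, hw, hs]
        refine ⟨hp2 ▸ Ideal.mul_mem_right _ _ hwm, ?_⟩
        have hsq : (signChar F (x + a * x⁻¹) : 𝒪) ^ 2 = 1 := by
          obtain h | h := signChar_eq_one_or (x + a * x⁻¹) <;> simp [h]
        rw [if_neg hx, hp2]
        linear_combination w ^ 2 * hsq
    have hp0 : algebraMap 𝒪 K (p - 1) ≠ 0 := by
      simpa only [ne_eq, map_eq_zero_iff _ hinj] using (hunit hpm).ne_zero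
    have hQ0 : algebraMap 𝒪 K ((isogeny c n).2.eval (r x)) ≠ 0 := by
      simpa only [ne_eq, map_eq_zero_iff _ hinj] using
        (isUnit_eval_isogeny_snd h2 c (r x) n).ne_zero
    rw [derivative_map, eval_map_apply, eval_map_apply, hd, map_mul, ← hpw, map_mul]
    field_simp
  have hsum := sum_eval_div_derivative (r := fun x => algebraMap 𝒪 K (r x))
    (G := G.map (algebraMap 𝒪 K)) (Q := (isogeny c n).2.map (algebraMap 𝒪 K))
    (fun x y h => ι.injective (by rw [← hrι, ← hrι, hinj h]))
    (by rw [hF]; exact natDegree_map_le.trans (natDegree_isogeny_sub_le c n))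
    (fun x => by rw [eval_map_apply, hr, map_zero])
    (by
      refine (degree_map_le.trans degree_le_natDegree).trans_lt ?_
      rw [hF]
      have := (natDegree_isogeny_le c n).2
      have hk : 0 < 2 ^ n := by positivity
      exact_mod_cast (by omega : (isogeny c n).2.natDegree < 2 ^ n))
  rw [hF, coeff_map, coeff_map, coeff_isogeny_snd, hw, hGc] at hsum
  refine ⟨a, fun h => ?_, hinj ?_⟩
  · rw [h, map_zero] at ha
    exact (residue_ne_zero_iff_isUnit _).2 (hc.isUnit 0) ha.symm
  · have h1 : algebraMap 𝒪 K (1 - w ^ 2) ≠ 0 := by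
      simpa only [ne_eq, map_eq_zero_iff _ hinj] using hw2.ne_zero
    have h3 := congrArg (· * algebraMap 𝒪 K (w ^ 2 - 1)) hsum
    simp only [sum_mul, hterm] at h3
    have h4 : algebraMap 𝒪 K (w ^ 2) / algebraMap 𝒪 K (1 - w ^ 2) * algebraMap 𝒪 K (w ^ 2 - 1) =
        algebraMap 𝒪 K (-w ^ 2) := by
      rw [← neg_sub 1, map_neg, map_neg]
      field_simp
    rw [h4, ← map_sum, sum_sub_distrib, sum_add_distrib, ← sum_mul] at h3
    have h5 := hinj h3
    rw [sum_ite_eq' univ (0 : F) (fun _ => w)] at h5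
    simp only [sum_const, card_univ, hF, mem_univ, if_true, nsmul_eq_mul, mul_one,
      ← Int.cast_sum] at h5
    congr 1
    push_cast [klSum] at h5 ⊢
    linear_combination h5

end FrobeniusTrace

section Reduction

open IsLocalRing

variable {K : Type*} [Field K] [CharZero K] {𝒪 : ValuationSubring K} {n : ℕ} {l : ℕ → K} {w : K}

omit [CharZero K] in
theorem IsLandenCycle.valuation_eq_one (h2 : 𝒪.valuation 2 < 1) (h : IsLandenCycle n l w)
    (hw : 𝒪.valuation w < 1) (k : ℕ) : 𝒪.valuation (l k) = 1 := by
  set v := 𝒪.valuation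
  have h4 : v 4 < 1 := by
    rw [show (4 : K) = 2 ^ 2 by norm_num, map_pow]
    exact pow_lt_one' h2 two_ne_zero
  have hn : 0 < n := by
    by_contra hn
    obtain rfl : n = 0 := by omega
    simp [← h.prod_eq] at hw
  by_contra hk
  have hstep (j) (hj : v (l j) ≠ 1) : v (l (j + 1)) < 1 := by
    have hv := congrArg v (h.landen j)
    simp only [map_mul, map_pow] at hv
    by_contra! hcon
    have hcon' : 1 ≤ v (l (j + 1)) ^ 2 := one_le_pow₀ hcon
    obtain hj | hj := lt_or_gt_of_ne hj
    · rw [v.map_one_add_of_lt hj, one_pow, mul_one] at hv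
      exact (mul_lt_one' h4 hj).not_ge (hv ▸ hcon')
    · rw [v.map_add_eq_of_lt_right (by rwa [map_one])] at hv
      have : v (l j) < v (l j) := calc
        v (l j) ≤ v (l j) ^ 2 := le_self_pow₀ hj.le two_ne_zero
        _ ≤ v (l (j + 1)) ^ 2 * v (l j) ^ 2 := le_mul_of_one_le_left' hcon'
        _ = v 4 * v (l j) := hv
        _ < v (l j) := mul_lt_of_lt_one_left (zero_lt_one.trans hj) h4
      exact this.false
  have hlt (j) : v (l (k + 1 + j)) < 1 := by
    induction j with
    | zero => exact hstep k hk
    | succ j ih => exact hstep _ ih.ne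
  have hall (j) : v (l j) < 1 := by
    rw [← h.periodic.nat_mul (k + 1) j]
    obtain ⟨d, hd⟩ : ∃ d, j + (k + 1) * n = k + 1 + d :=
      Nat.exists_eq_add_of_le (by nlinarith)
    simpa [hd] using hlt d
  rw [← h.prod_eq, map_prod, prod_eq_one fun j _ => v.map_one_add_of_lt (hall j)] at hw
  exact hw.false

theorem IsLandenCycle.exists_isUnitCycle (h2 : 𝒪.valuation 2 < 1) (h : IsLandenCycle n l w)
    (hw : 𝒪.valuation w < 1) : ∃ c : ℕ → 𝒪, IsUnitCycle n c ∧
      ((∏ k ∈ range n, (2 * (1 + 4 * c k)) : 𝒪) : K) = w := by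
  have hl := h.valuation_eq_one h2 hw
  set v := 𝒪.valuation
  have h20 : v 2 ≠ 0 := by simp
  have h40 : v 4 ≠ 0 := by simp
  have h1l (k) : v ((1 + l k) / 2) = 1 := by
    have hv := congrArg v (h.landen k)
    rw [show (4 : K) = 2 ^ 2 by norm_num, map_mul, map_pow, hl, map_mul, map_pow, map_pow, hl, one_pow,
      one_mul, mul_one] at hv
    rw [map_div₀, (pow_left_inj₀ zero_le zero_le two_ne_zero).1 hv, div_self h20]
  have hne (k) : v ((l k - 1) / 8) ≠ 0 := by simp [sub_eq_zero, h.ne_one k]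
  have hrel (k) : (l (k + 1) - 1) / 8 * (1 + 4 * ((l (k + 1) - 1) / 8)) *
      (1 + 4 * ((l k - 1) / 8)) ^ 2 = -((l k - 1) / 8) ^ 2 := by
    linear_combination h.landen k / 64
  have hh (k) : 1 + 4 * ((l k - 1) / 8) = (1 + l k) / 2 := by ring
  have hsq (k) : v ((l (k + 1) - 1) / 8) = v ((l k - 1) / 8) ^ 2 := by
    have hv := congrArg v (hrel k)
    rwa [hh, hh, map_mul, map_mul, map_pow, h1l, h1l, one_pow, mul_one, mul_one, Valuation.map_neg,
      map_pow] at hv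
  have hn : n ≠ 0 := by
    rintro rfl
    simp [← h.prod_eq] at hw
  have hone (k) : v ((l k - 1) / 8) = 1 := by
    have h3 := eq_pow_two_pow (x := fun j => v ((l (k + j) - 1) / 8)) (fun j => hsq (k + j)) n
    simp only [h.periodic k, add_zero] at h3
    have hk : 2 ^ n - 1 ≠ 0 := by
      have := Nat.one_lt_two_pow hn
      omega
    refine (pow_left_inj₀ zero_le zero_le hk).1 (mul_left_cancel₀ (hne k) ?_)
    rw [one_pow, mul_one, ← pow_succ', Nat.sub_add_cancel Nat.one_le_two_pow, ← h3]
  refine ⟨fun k => ⟨(l k - 1) / 8, 𝒪.mem_of_valuation_le_one _ (hone k).le⟩,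
    ⟨fun k => ?_, fun k => ?_, fun k => ?_⟩, ?_⟩
  · simp [h.periodic k]
  · exact (𝒪.valuation_eq_one_iff _).2 (hone k)
  · exact Subtype.ext (hrel k)
  · rw [← h.prod_eq]
    have := map_prod (algebraMap 𝒪 K) (fun k => 2 * (1 + 4 *
      (⟨(l k - 1) / 8, 𝒪.mem_of_valuation_le_one _ (hone k).le⟩ : 𝒪))) (range n)
    refine this.trans (prod_congr rfl fun k _ => ?_)
    rw [map_mul, map_add, map_mul, map_one, map_ofNat, map_ofNat]
    change 2 * (1 + 4 * ((l k - 1) / 8)) = _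
    ring

end Reduction

section Existence

open IsLocalRing

theorem exists_valuationSubring_two (K : Type*) [Field K] [CharZero K] :
    ∃ 𝒪 : ValuationSubring K, 𝒪.valuation 2 < 1 := by
  obtain ⟨𝒪, -, h⟩ := Ideal.image_subset_nonunits_valuationSubring
    (A := (Int.castRingHom K).range) (Ideal.span {2}) (by
      rw [Ne, Ideal.span_singleton_eq_top, isUnit_iff_exists_inv]
      rintro ⟨⟨-, m, rfl⟩, hm⟩
      have hm : (2 : K) * m = 1 := congrArg Subtype.val hm
      have : 2 * m = 1 := by exact_mod_cast hm
      omega)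
  exact ⟨𝒪, h ⟨2, Ideal.mem_span_singleton_self _, rfl⟩⟩

variable {F : Type*} [Field F] [Fintype F] [Algebra (ZMod 2) F]

/-- Every `1 - t` with `t ≡ 1 mod 4` in the Hasse interval is a Kloosterman sum. -/
theorem exists_klSum_eq {n : ℕ} (hn : 2 ≤ n) (hF : Fintype.card F = 2 ^ n) {t : ℤ}
    (ht : 4 ∣ t - 1) (htn : t ^ 2 < 4 * 2 ^ n) : ∃ a : F, a ≠ 0 ∧ klSum a = 1 - t := by
  obtain ⟨l, w, hl, hw, hwim⟩ := exists_isLandenCycle hn ht htn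
  obtain ⟨𝒪, h2⟩ := exists_valuationSubring_two ℂ
  obtain ⟨l, w, hl, hw, hwv⟩ : ∃ (l : ℕ → ℂ) (w : ℂ), IsLandenCycle n l w ∧
      w ^ 2 - t * w + 2 ^ n = 0 ∧ 𝒪.valuation w < 1 := by
    by_cases hv : 𝒪.valuation w < 1
    · exact ⟨l, w, hl, hw, hv⟩
    have hw' : starRingEnd ℂ w ^ 2 - t * starRingEnd ℂ w + 2 ^ n = 0 := by
      simpa [map_ofNat] using congrArg (starRingEnd ℂ) hw
    refine ⟨_, _, hl.map (starRingEnd ℂ), hw', ?_⟩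
    have hprod : w * starRingEnd ℂ w = 2 ^ n := by
      have hne : w - starRingEnd ℂ w ≠ 0 := by
        rw [sub_ne_zero, ne_comm, Ne, Complex.conj_eq_iff_im]
        exact hwim
      refine mul_left_cancel₀ hne ?_
      linear_combination starRingEnd ℂ w * hw - w * hw'
    have h3 := congrArg 𝒪.valuation hprod
    rw [map_mul, map_pow] at h3
    have h4 : 𝒪.valuation 2 ^ n < 1 := pow_lt_one' h2 (by omega)
    by_contra! hv'
    exact h4.not_ge (h3 ▸ one_le_mul (not_lt.1 hv) hv')
  obtain ⟨c, hc, hcw⟩ := hl.exists_isUnitCycle h2 hwv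
  have h2m : (2 : 𝒪) ∈ maximalIdeal 𝒪 := (𝒪.valuation_lt_one_iff 2).2 h2
  obtain ⟨a, ha, hk⟩ := hc.exists_klSum (F := F) h2m two_ne_zero hF rfl
  refine ⟨a, ha, ?_⟩
  have hk' := congrArg (algebraMap 𝒪 ℂ) hk
  rw [map_add, map_add, map_mul, map_sub, map_pow, map_pow, map_intCast, map_one, map_zero,
    map_ofNat, show algebraMap 𝒪 ℂ _ = w from hcw] at hk'
  have hw0 : w ≠ 0 := by
    rintro rfl
    simp at hw
  have : (klSum a : ℂ) = ((1 - t : ℤ) : ℂ) := by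
    refine mul_right_cancel₀ hw0 ?_
    push_cast
    linear_combination hk' - hw
  exact_mod_cast this

end Existence

section WeilSum

variable {F : Type*} [Field F] [Fintype F] [CharP F 2]

theorem canonicalPsi_eq_signChar (x : F) :
    letI : Algebra (ZMod 2) F := ZMod.algebra F 2
    canonicalPsi F 2 x = signChar F x := by
  let _ : Algebra (ZMod 2) F := ZMod.algebra F 2
  rw [signChar_apply, canonicalPsi]
  generalize Algebra.trace (ZMod 2) F x = u
  have hu : u = 0 ∨ u = 1 := by
    revert u
    decide
  obtain rfl | rfl := hu
  · simp
  · have : 2 * (Real.pi : ℂ) * Complex.I / 2 = Real.pi * Complex.I := by ring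
    simp [ZMod.val_one, this, Complex.exp_pi_mul_I]

theorem weilSum_card_sub_two (hF : Fintype.card F ≠ 2) (a : F) :
    letI : Algebra (ZMod 2) F := ZMod.algebra F 2
    weilSum F 2 (Fintype.card F - 2) a = klSum a := by
  let _ : Algebra (ZMod 2) F := ZMod.algebra F 2
  have hlt : 1 < Fintype.card F := Fintype.one_lt_card
  rw [weilSum, klSum, Int.cast_sum]
  refine Fintype.sum_equiv (Equiv.inv F) _ _ fun x => ?_
  rw [canonicalPsi_eq_signChar, Equiv.inv_apply, inv_inv, CharTwo.sub_eq_add]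
  congr 3
  by_cases hx : x = 0
  · rw [hx, inv_zero, zero_pow (by omega)]
  · refine eq_inv_of_mul_eq_one_left ?_
    rw [← pow_succ, show Fintype.card F - 2 + 1 = Fintype.card F - 1 by omega,
      FiniteField.pow_card_sub_one_eq_one x hx]

theorem weilSum_of_card_eq_two (hF : Fintype.card F = 2) {a : F} (ha : a ≠ 0) :
    weilSum F 2 (Fintype.card F - 2) a = 0 := by
  let _ : Algebra (ZMod 2) F := ZMod.algebra F 2
  classical
  have h (x : F) : signChar F (x ^ (Fintype.card F - 2) - a * x) =
      signChar F 1 * signChar F (x * a) := by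
    rw [hF, pow_zero, CharTwo.sub_eq_add, AddChar.map_add_eq_mul, mul_comm a]
  simp only [weilSum, canonicalPsi_eq_signChar, h]
  rw [← Int.cast_sum, ← mul_sum, sum_signChar_mul, if_neg ha, mul_zero, Int.cast_zero]

end WeilSum

end Kloosterman

/-- Lachaud-Wolfmann: in characteristic `2`, the Weil spectrum of `d = q − 2` is exactly
the set of integers divisible by `4` in the interval `[1 − 2√q, 1 + 2√q]`. -/
theorem weilSpectrum_kloosterman_char_two (F : Type*) [Field F] [Fintype F] [CharP F 2] :
    {w : ℂ | ∃ a : F, a ≠ 0 ∧ weilSum F 2 (Fintype.card F - 2) a = w} =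
      {w : ℂ | ∃ t : ℤ, w = (t : ℂ) ∧ (4 : ℤ) ∣ t ∧
        1 - 2 * Real.sqrt (Fintype.card F) ≤ (t : ℝ) ∧
        (t : ℝ) ≤ 1 + 2 * Real.sqrt (Fintype.card F)} := by
  let _ : Algebra (ZMod 2) F := ZMod.algebra F 2
  obtain ⟨n, hn⟩ : ∃ n, Fintype.card F = 2 ^ n := by
    obtain ⟨n, -, hn⟩ := FiniteField.card F 2
    exact ⟨n, hn⟩
  have hinterval (t : ℤ) : (1 - 2 * Real.sqrt (Fintype.card F) ≤ (t : ℝ) ∧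
      (t : ℝ) ≤ 1 + 2 * Real.sqrt (Fintype.card F)) ↔ (t - 1) ^ 2 ≤ 4 * Fintype.card F := by
    have hs : Real.sqrt (Fintype.card F) ^ 2 = Fintype.card F := Real.sq_sqrt (Nat.cast_nonneg _)
    have hs0 := Real.sqrt_nonneg (Fintype.card F)
    calc _ ↔ |(t : ℝ) - 1| ≤ |2 * Real.sqrt (Fintype.card F)| := by
          rw [abs_of_nonneg (a := 2 * Real.sqrt _) (by positivity), abs_le]
          constructor <;> rintro ⟨h1, h2⟩ <;> constructor <;> linarith
      _ ↔ ((t : ℝ) - 1) ^ 2 ≤ 4 * Fintype.card F := by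
          rw [← sq_le_sq, mul_pow, hs]; norm_num
      _ ↔ _ := by exact_mod_cast Iff.rfl
  ext w
  simp only [Set.mem_ofPred_eq, hinterval]
  by_cases h2 : Fintype.card F = 2
  · constructor
    · rintro ⟨a, ha, rfl⟩
      refine ⟨0, ?_, dvd_zero _, by simp [h2]⟩
      rw [Kloosterman.weilSum_of_card_eq_two h2 ha, Int.cast_zero]
    · rintro ⟨t, rfl, ⟨s, rfl⟩, ht⟩
      refine ⟨1, one_ne_zero, ?_⟩
      have hs : s = 0 := by
        rw [h2] at ht
        push_cast at ht
        have h1 : s < 1 := by nlinarith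
        have h3 : -1 < s := by nlinarith
        omega
      rw [Kloosterman.weilSum_of_card_eq_two h2 one_ne_zero, hs, mul_zero, Int.cast_zero]
  · have hn2 : 2 ≤ n := by
      by_contra! hlt
      have h1 := Fintype.one_lt_card (α := F)
      interval_cases n <;> simp_all
    simp only [Kloosterman.weilSum_card_sub_two h2]
    constructor
    · rintro ⟨a, ha, rfl⟩
      exact ⟨_, rfl, Kloosterman.four_dvd_klSum (hn ▸ pow_dvd_pow 2 hn2) ha,
        Kloosterman.klSum_sub_one_sq_le ha⟩
    · rintro ⟨t, rfl, h4, ht⟩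
      have hlt : (1 - t) ^ 2 < 4 * 2 ^ n := by
        refine lt_of_le_of_ne ?_ fun h => ?_
        · rw [hn] at ht
          push_cast at ht
          linarith
        · obtain ⟨s, rfl⟩ := h4
          have : 2 * (2 * 2 ^ n + 4 * s - 8 * s ^ 2) = 1 := by linear_combination -h
          omega
      obtain ⟨a, ha, hat⟩ := Kloosterman.exists_klSum_eq (F := F) hn2 hn (t := 1 - t)
        (by simpa using h4) hlt
      exact ⟨a, ha, by rw [hat]; simp⟩
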